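/- arXiv:2603.19813 — 5 statements merged into one kernel-verified Lean document; each statement's English description precedes it below -/
import Mathlib

section
/- The spectral radius r of the integral operator T satisfies 0 < r ≤ 1, and r is an eigenvalue of T: there exists ψ ∈ C(K,ℝ) with ψ not identically zero, ψ(x) ≥ 0 for all x ∈ K, and Tψ = r·ψ. -/
open MeasureTheory

/-- The Lebesgue measure on `ℝ^d` restricted to (i.e., viewed on) the subset `K`. -/
noncomputable def lebOn {d : ℕ} (K : Set (EuclideanSpace ℝ (Fin d))) : Measure ↥K :=
  Measure.comap Subtype.val volume

open Filter Topology

lemma aux_compact {X : Type*} [MetricSpace X] [CompactSpace X] [MeasurableSpace X] [BorelSpace X]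
    (ν : Measure X) [IsFiniteMeasure ν] (P : X × X → ℝ) (hP : Continuous P)
    (T : C(X, ℝ) →L[ℝ] C(X, ℝ))
    (hT : ∀ (β : C(X, ℝ)) (x : X), T β x = ∫ y, β y * P (x, y) ∂ν) : IsCompactOperator T := by
  refine (isCompactOperator_iff_isCompact_closure_image_closedBall (T : C(X, ℝ) →ₗ[ℝ] C(X, ℝ))
    one_pos).2 ?_
  have key := BoundedContinuousFunction.arzela_ascoli (Metric.closedBall (0:ℝ) ‖T‖)
    (isCompact_closedBall _ _)
    ((ContinuousMap.isometryEquivBoundedOfCompact X ℝ) '' (T '' Metric.closedBall 0 1)) ?_ ?_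
  · have h2 := key.image (ContinuousMap.isometryEquivBoundedOfCompact X ℝ).symm.continuous
    have h3 := (ContinuousMap.isometryEquivBoundedOfCompact X ℝ).toHomeomorph.image_closure
      (T '' Metric.closedBall 0 1)
    simp only [IsometryEquiv.coe_toHomeomorph] at h3
    rw [← h3, ← Set.image_comp] at h2
    have h4 : ((ContinuousMap.isometryEquivBoundedOfCompact X ℝ).symm ∘
        (ContinuousMap.isometryEquivBoundedOfCompact X ℝ)) = id := by
      funext a
      exact (ContinuousMap.isometryEquivBoundedOfCompact X ℝ).symm_apply_apply a
    rw [h4, Set.image_id] at h2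
    exact h2
  · rintro _ x ⟨_, ⟨β, hβ, rfl⟩, rfl⟩
    simp only [Metric.mem_closedBall, dist_zero_right] at hβ ⊢
    calc ‖T β x‖ ≤ ‖T β‖ := (T β).norm_coe_le_norm x
      _ ≤ ‖T‖ * ‖β‖ := T.le_opNorm β
      _ ≤ ‖T‖ := mul_le_of_le_one_right (norm_nonneg T) hβ
  · have huc : UniformContinuous P := CompactSpace.uniformContinuous_of_continuous hP
    refine UniformEquicontinuous.equicontinuous ?_
    rw [Metric.uniformEquicontinuous_iff]
    intro ε hε
    set M := ν.real Set.univ with hM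
    have hM0 : 0 ≤ M := measureReal_nonneg
    obtain ⟨δ, hδ, h⟩ := Metric.uniformContinuous_iff.1 huc (ε / (M + 1)) (by positivity)
    refine ⟨δ, hδ, ?_⟩
    rintro x x' hxx ⟨_, ⟨_, ⟨β, hβ, rfl⟩, rfl⟩⟩
    simp only [Metric.mem_closedBall, dist_zero_right] at hβ
    change dist (T β x) (T β x') < ε
    have hint : ∀ z, Integrable (fun y => β y * P (z, y)) ν := fun z =>
      (by fun_prop : Continuous (fun y => β y * P (z, y))).integrable_of_hasCompactSupport
        (HasCompactSupport.of_compactSpace _)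
    rw [hT, hT, Real.dist_eq, ← integral_sub (hint x) (hint x')]
    have := norm_integral_le_of_norm_le_const (μ := ν) (C := ε / (M + 1))
      (f := fun y => β y * P (x, y) - β y * P (x', y)) (Eventually.of_forall fun y => by
        have h1 := h (a := (x, y)) (b := (x', y)) (by simpa [Prod.dist_eq] using hxx)
        rw [Real.dist_eq] at h1
        rw [← mul_sub, norm_mul]
        have h2 : ‖β y‖ ≤ 1 := (β.norm_coe_le_norm y).trans hβ
        calc _ ≤ 1 * ‖P (x, y) - P (x', y)‖ := by gcongr
          _ ≤ _ := by rw [one_mul]; exact h1.le)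
    rw [Real.norm_eq_abs] at this
    refine this.trans_lt ?_
    rw [← hM, div_mul_eq_mul_div, div_lt_iff₀ (by positivity)]
    nlinarith

lemma aux_strong {X : Type*} [TopologicalSpace X] [CompactSpace X] [Nonempty X]
    (S : C(X, ℝ) →L[ℝ] C(X, ℝ)) (hS : IsCompactOperator S)
    (hpos : ∀ h : C(X, ℝ), (∀ x, 0 ≤ h x) → h ≠ 0 → ∃ δ > 0, ∀ x, δ ≤ S h x) :
    ∃ l : ℝ, 0 < l ∧ (∃ ψ : C(X, ℝ), (∀ x, 0 ≤ ψ x) ∧ ‖ψ‖ = 1 ∧ S ψ = l • ψ) ∧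
      ∀ (m : ℝ) (φ : C(X, ℝ)), (∀ x, 0 ≤ φ x) → φ ≠ 0 → (∀ x, m * φ x ≤ S φ x) → m ≤ l := by
  have hnn : ∀ h : C(X, ℝ), (∀ x, 0 ≤ h x) → ∀ x, 0 ≤ S h x := by
    intro h hh x
    by_cases h0 : h = 0
    · simp [h0]
    · obtain ⟨δ, hδ, H⟩ := hpos h hh h0
      exact hδ.le.trans (H x)
  let A : Set ℝ := {m | ∃ φ : C(X, ℝ), (∀ x, 0 ≤ φ x) ∧ ‖φ‖ = 1 ∧ ∀ x, m * φ x ≤ S φ x}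
  have hA : ∀ (m : ℝ) (φ : C(X, ℝ)), (∀ x, 0 ≤ φ x) → φ ≠ 0 → (∀ x, m * φ x ≤ S φ x) → m ∈ A := by
    intro m φ h1 h2 h3
    have hn : 0 < ‖φ‖ := norm_pos_iff.2 h2
    refine ⟨‖φ‖⁻¹ • φ, fun x => ?_, ?_, fun x => ?_⟩
    · have := h1 x
      simp only [ContinuousMap.smul_apply, smul_eq_mul]; positivity
    · rw [norm_smul, norm_inv, norm_norm, inv_mul_cancel₀ hn.ne']
    · rw [map_smul]
      simp only [ContinuousMap.smul_apply, smul_eq_mul]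
      have := mul_le_mul_of_nonneg_left (h3 x) (inv_nonneg.2 hn.le)
      linarith
  have hbd : BddAbove A := by
    refine ⟨‖S‖, ?_⟩
    rintro m ⟨φ, h1, h2, h3⟩
    by_contra! hm
    have hm0 : 0 < m := (norm_nonneg S).trans_lt hm
    have h4 : ‖φ‖ ≤ ‖S‖ / m := by
      rw [ContinuousMap.norm_le _ (by positivity)]
      intro x
      rw [Real.norm_eq_abs, abs_of_nonneg (h1 x), le_div_iff₀ hm0]
      have h5 := (le_abs_self _).trans ((S φ).norm_coe_le_norm x)
      have h6 := S.le_opNorm φ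
      rw [h2] at h6
      linarith [h3 x]
    rw [h2, le_div_iff₀ hm0] at h4
    linarith
  obtain ⟨δ, hδ, H1⟩ := hpos 1 (fun x => by simp) one_ne_zero
  have hδA : δ ∈ A := hA δ 1 (fun x => by simp) one_ne_zero (fun x => by simpa using H1 x)
  set l := sSup A with hl
  have hl0 : 0 < l := hδ.trans_le (le_csSup hbd hδA)
  have hlA : ∀ (m : ℝ) (φ : C(X, ℝ)), (∀ x, 0 ≤ φ x) → φ ≠ 0 → (∀ x, m * φ x ≤ S φ x) → m ≤ l :=
    fun m φ h1 h2 h3 => le_csSup hbd (hA m φ h1 h2 h3)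
  refine ⟨l, hl0, ?_, hlA⟩
  obtain ⟨u, -, hu, huA⟩ := exists_seq_tendsto_sSup ⟨δ, hδA⟩ hbd
  choose φ hφ0 hφ1 hφ using huA
  have hc := hS.isCompact_closure_image_closedBall (f := (S : C(X, ℝ) →ₗ[ℝ] C(X, ℝ))) 1
  obtain ⟨g, -, s, hs, hg⟩ := hc.tendsto_subseq (x := fun n => S (φ n))
    (fun n => subset_closure ⟨φ n, by simp [hφ1], rfl⟩)
  have hev : ∀ x, Continuous fun f : C(X, ℝ) => f x := fun x => continuous_eval_const x
  have hgx : ∀ x, Tendsto (fun n => S (φ (s n)) x) atTop (𝓝 (g x)) := fun x =>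
    ((hev x).tendsto g).comp hg
  have hus : Tendsto (fun n => u (s n)) atTop (𝓝 l) := hu.comp hs.tendsto_atTop
  have hg0 : ∀ x, 0 ≤ g x := fun x => ge_of_tendsto' (hgx x) fun n => hnn _ (hφ0 _) x
  have hgn : l ≤ ‖g‖ := by
    refine le_of_tendsto_of_tendsto' hus hg.norm fun n => ?_
    rcases le_or_gt (u (s n)) 0 with h | h
    · exact h.trans (norm_nonneg _)
    have : ‖φ (s n)‖ ≤ ‖S (φ (s n))‖ / u (s n) := by
      rw [ContinuousMap.norm_le _ (by positivity)]
      intro x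
      rw [Real.norm_eq_abs, abs_of_nonneg (hφ0 _ x), le_div_iff₀ h]
      have h5 := (le_abs_self _).trans ((S (φ (s n))).norm_coe_le_norm x)
      linarith [hφ (s n) x]
    rw [hφ1, le_div_iff₀ h, one_mul] at this
    exact this
  have hgne : g ≠ 0 := norm_pos_iff.1 (hl0.trans_le hgn)
  have hSg : ∀ x, l * g x ≤ S g x := by
    intro x
    have h1 : Tendsto (fun n => S (S (φ (s n))) x) atTop (𝓝 (S g x)) :=
      (((hev x).comp S.continuous).tendsto g).comp hg
    refine le_of_tendsto_of_tendsto' (hus.mul (hgx x)) h1 fun n => ?_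
    have := hnn (S (φ (s n)) - u (s n) • φ (s n)) (fun y => by
      simpa using hφ (s n) y) x
    simpa using this
  have hEq : S g = l • g := by
    by_contra hne
    obtain ⟨ε, hε, H⟩ := hpos (S g - l • g) (fun x => by simpa using hSg x) (sub_ne_zero.2 hne)
    have hSgne : S g ≠ 0 := by
      intro h
      apply hgne
      ext x
      have := hSg x
      rw [h] at this
      simp only [ContinuousMap.zero_apply] at this ⊢
      nlinarith [hg0 x]
    have := hlA (l + ε / (‖S g‖ + 1)) (S g) (hnn g hg0) hSgne (fun x => by
      have h1 := H x
      simp only [map_sub, map_smul, ContinuousMap.sub_apply, ContinuousMap.smul_apply,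
        smul_eq_mul] at h1
      have h2 : ε / (‖S g‖ + 1) * S g x ≤ ε := by
        rw [div_mul_eq_mul_div, div_le_iff₀ (by positivity)]
        have h5 := (le_abs_self _).trans ((S g).norm_coe_le_norm x)
        gcongr
        linarith
      linarith)
    have : 0 < ε / (‖S g‖ + 1) := by positivity
    linarith
  have hn : 0 < ‖g‖ := norm_pos_iff.2 hgne
  refine ⟨‖g‖⁻¹ • g, fun x => ?_, ?_, ?_⟩
  · have := hg0 x
    simp only [ContinuousMap.smul_apply, smul_eq_mul]; positivity
  · rw [norm_smul, norm_inv, norm_norm, inv_mul_cancel₀ hn.ne']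
  · rw [map_smul, hEq, smul_comm]

lemma aux_main {X : Type*} [MetricSpace X] [CompactSpace X] [Nonempty X]
    [MeasurableSpace X] [BorelSpace X]
    (ν : Measure X) [IsFiniteMeasure ν] [ν.IsOpenPosMeasure] (P : X × X → ℝ) (hP : Continuous P)
    (hP0 : ∀ x y, 0 ≤ P (x, y)) (x₀ : X) (hx₀ : 0 < P (x₀, x₀))
    (T : C(X, ℝ) →L[ℝ] C(X, ℝ))
    (hT : ∀ (β : C(X, ℝ)) (x : X), T β x = ∫ y, β y * P (x, y) ∂ν) :
    ∃ l : ℝ, 0 < l ∧ (∃ ψ : C(X, ℝ), (∀ x, 0 ≤ ψ x) ∧ ‖ψ‖ = 1 ∧ T ψ = l • ψ) ∧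
      ∀ (m : ℝ) (φ : C(X, ℝ)), (∀ x, 0 ≤ φ x) → φ ≠ 0 → (∀ x, m * φ x ≤ T φ x) → m ≤ l := by
  have hint : ∀ f : X → ℝ, Continuous f → Integrable f ν := fun f hf =>
    hf.integrable_of_hasCompactSupport (HasCompactSupport.of_compactSpace _)
  have hipos : ∀ h : C(X, ℝ), (∀ x, 0 ≤ h x) → h ≠ 0 → 0 < ∫ y, h y ∂ν := by
    intro h h0 hne
    obtain ⟨x, hx⟩ := DFunLike.ne_iff.1 hne
    exact integral_pos_of_integrable_nonneg_nonzero h.continuous (hint _ h.continuous) h0 hx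
  have hTc := aux_compact ν P hP T hT
  have hTnn : ∀ h : C(X, ℝ), (∀ x, 0 ≤ h x) → ∀ x, 0 ≤ T h x := fun h hh x => by
    rw [hT]; exact integral_nonneg fun y => mul_nonneg (hh y) (hP0 x y)
  let J : C(X, ℝ) →L[ℝ] C(X, ℝ) := LinearMap.mkContinuous
    { toFun := fun β => (ContinuousMap.const X (∫ y, β y ∂ν))
      map_add' := fun a b => by
        ext x
        simp [integral_add (hint _ a.continuous) (hint _ b.continuous)]
      map_smul' := fun c a => by
        ext x
        simp [integral_const_mul] } (ν.real Set.univ) (fun β => by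
      rw [ContinuousMap.norm_le _ (by positivity)]
      intro x
      rw [mul_comm]
      exact norm_integral_le_of_norm_le_const (Eventually.of_forall fun y => β.norm_coe_le_norm y))
  have hJ : ∀ β x, J β x = ∫ y, β y ∂ν := fun β x => rfl
  have hJc : IsCompactOperator J := aux_compact ν (fun _ => 1) continuous_const J (by simp [hJ])
  let ε : ℕ → ℝ := fun n => 1 / ((n : ℝ) + 1)
  have hε : ∀ n, 0 < ε n := fun n => Nat.one_div_pos_of_nat
  have hε1 : ∀ n, ε n ≤ 1 := fun n => by
    simp only [ε]; rw [div_le_one (by positivity)]; linarith [n.cast_nonneg (α := ℝ)]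
  have hεt : Tendsto ε atTop (𝓝 0) := tendsto_one_div_add_atTop_nhds_zero_nat
  have hstr := fun n => aux_strong (T + ε n • J) (hTc.add (hJc.smul (ε n))) (by
    intro h h0 hne
    refine ⟨ε n * ∫ y, h y ∂ν, mul_pos (hε n) (hipos h h0 hne), fun x => ?_⟩
    have := hTnn h h0 x
    simp [hJ, this])
  choose l hl0 hψ hmax using hstr
  choose ψ hψ0 hψ1 hψe using hψ
  have hmaxT : ∀ n (m : ℝ) (φ : C(X, ℝ)), (∀ x, 0 ≤ φ x) → φ ≠ 0 →
      (∀ x, m * φ x ≤ T φ x) → m ≤ l n := by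
    intro n m φ h0 h1 h2
    refine hmax n m φ h0 h1 fun x => ?_
    have : 0 ≤ ε n * ∫ y, φ y ∂ν := mul_nonneg (hε n).le (hipos φ h0 h1).le
    simp [hJ]
    linarith [h2 x]
  -- bump
  obtain ⟨m, hm, hml⟩ : ∃ m > 0, ∀ n, m ≤ l n := by
    obtain ⟨δ, hδ, hb⟩ := Metric.continuous_iff.1 hP (x₀, x₀) (P (x₀, x₀) / 2) (by positivity)
    let φ : C(X, ℝ) := ⟨fun x => max 0 (δ - dist x x₀), by fun_prop⟩
    have hφ0 : ∀ x, 0 ≤ φ x := fun x => le_max_left _ _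
    have hφδ : ∀ x, φ x ≤ δ := fun x => max_le hδ.le (by linarith [dist_nonneg (x := x) (y := x₀)])
    have hφs : ∀ x, φ x ≠ 0 → dist x x₀ < δ := fun x hx => by
      by_contra! hh
      exact hx (max_eq_left (by linarith))
    have hφne : φ ≠ 0 := by
      intro h
      have := DFunLike.congr_fun h x₀
      simp [φ] at this
      linarith
    have hI := hipos φ hφ0 hφne
    refine ⟨P (x₀, x₀) / 2 * (∫ y, φ y ∂ν) / δ, by positivity, fun n => ?_⟩
    refine hmaxT n _ φ hφ0 hφne fun x => ?_
    by_cases hx : φ x = 0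
    · rw [hx, mul_zero]; exact hTnn φ hφ0 x
    have h1 : P (x₀, x₀) / 2 * (∫ y, φ y ∂ν) ≤ T φ x := by
      rw [hT, ← integral_const_mul]
      refine integral_mono (hint _ (by fun_prop)) (hint _ (by fun_prop)) fun y => ?_
      simp only
      by_cases hy : φ y = 0
      · simp [hy]
      have := hb (x, y) (by simp [Prod.dist_eq, hφs x hx, hφs y hy])
      rw [Real.dist_eq, abs_lt] at this
      rw [mul_comm]
      exact mul_le_mul_of_nonneg_left (by linarith) (hφ0 y)
    refine le_trans ?_ h1
    rw [div_mul_eq_mul_div, div_le_iff₀ hδ]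
    exact mul_le_mul_of_nonneg_left (hφδ x) (by positivity)
  have hlb : ∀ n, l n ≤ ‖T‖ + ‖J‖ := by
    intro n
    have h1 : ‖(T + ε n • J) (ψ n)‖ = l n := by
      rw [hψe, norm_smul, hψ1, mul_one, Real.norm_eq_abs, abs_of_pos (hl0 n)]
    rw [← h1]
    refine ((T + ε n • J).le_opNorm _).trans ?_
    rw [hψ1, mul_one]
    refine (norm_add_le _ _).trans ?_
    gcongr
    rw [norm_smul, Real.norm_eq_abs, abs_of_pos (hε n)]
    exact mul_le_of_le_one_left (norm_nonneg _) (hε1 n)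
  have hc := hTc.isCompact_closure_image_closedBall (f := (T : C(X, ℝ) →ₗ[ℝ] C(X, ℝ))) 1
  obtain ⟨⟨L, g⟩, hLg, s, hs, hg⟩ := ((isCompact_Icc (a := m) (b := ‖T‖ + ‖J‖)).prod hc).tendsto_subseq
    (x := fun n => (l n, T (ψ n)))
    (fun n => ⟨⟨hml n, hlb n⟩, subset_closure ⟨ψ n, by simp [hψ1], rfl⟩⟩)
  have hLt : Tendsto (fun n => l (s n)) atTop (𝓝 L) := (continuous_fst.tendsto _).comp hg
  have hgt : Tendsto (fun n => T (ψ (s n))) atTop (𝓝 g) := (continuous_snd.tendsto _).comp hg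
  have hL0 : 0 < L := hm.trans_le hLg.1.1
  have hJ0 : Tendsto (fun n => ε (s n) • J (ψ (s n))) atTop (𝓝 0) := by
    refine squeeze_zero_norm (a := fun n => ε (s n) * ‖J‖) (fun n => ?_) ?_
    · rw [norm_smul, Real.norm_eq_abs, abs_of_pos (hε _)]
      have := J.le_opNorm (ψ (s n))
      rw [hψ1, mul_one] at this
      exact mul_le_mul_of_nonneg_left this (hε _).le
    · simpa using (hεt.comp hs.tendsto_atTop).mul_const ‖J‖
  have hψt : Tendsto (fun n => ψ (s n)) atTop (𝓝 (L⁻¹ • g)) := by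
    have h1 := (hLt.inv₀ hL0.ne').smul (hgt.add hJ0)
    rw [add_zero] at h1
    refine h1.congr fun n => ?_
    have h2 := hψe (s n)
    simp only [add_apply, smul_apply] at h2
    rw [h2, inv_smul_smul₀ (hl0 _).ne']
  refine ⟨L, hL0, ⟨L⁻¹ • g, fun x => ?_, ?_, ?_⟩, ?_⟩
  · exact ge_of_tendsto' (((continuous_eval_const x).tendsto _).comp hψt) fun n => hψ0 _ x
  · exact tendsto_nhds_unique hψt.norm (by simp [hψ1])
  · rw [smul_inv_smul₀ hL0.ne']
    exact tendsto_nhds_unique ((T.continuous.tendsto _).comp hψt) hgt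
  · intro a φ h0 h1 h2
    exact ge_of_tendsto' hLt fun n => hmaxT _ a φ h0 h1 h2

/-- The spectral radius `r` of the integral operator `T` satisfies `0 < r ≤ 1`, and `r`
is an eigenvalue of `T` with a nonnegative eigenfunction. -/
theorem stmt_3 {d : ℕ} (K : Set (EuclideanSpace ℝ (Fin d)))
    [Nonempty ↥K] [CompactSpace ↥K]
    (hKint : (interior K).Nonempty) (hKreg : K = closure (interior K))
    (P : ↥K × ↥K → ℝ) (hPcont : Continuous P)
    (hPnonneg : ∀ x y : ↥K, 0 ≤ P (x, y))
    (hPpos : ∀ x y : ↥K, (x : EuclideanSpace ℝ (Fin d)) ∈ interior K →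
      (y : EuclideanSpace ℝ (Fin d)) ∈ interior K → 0 < P (x, y))
    (hPsub : ∀ x : ↥K, ∫ y : ↥K, P (x, y) ∂(lebOn K) ≤ 1)
    (T : C(↥K, ℝ) →L[ℝ] C(↥K, ℝ))
    (hT : ∀ (β : C(↥K, ℝ)) (x : ↥K), T β x = ∫ y : ↥K, β y * P (x, y) ∂(lebOn K)) :
    0 < (spectralRadius ℝ T).toReal ∧ (spectralRadius ℝ T).toReal ≤ 1 ∧
    ∃ ψ : C(↥K, ℝ), ψ ≠ 0 ∧ (∀ x : ↥K, 0 ≤ ψ x) ∧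
      T ψ = (spectralRadius ℝ T).toReal • ψ := by
  have hKc : IsCompact K := isCompact_iff_compactSpace.2 inferInstance
  have hKm : MeasurableSet K := hKc.isClosed.measurableSet
  have hfin : IsFiniteMeasure (lebOn K) := by
    constructor
    rw [lebOn, (MeasurableEmbedding.subtype_coe hKm).comap_apply]
    simpa using hKc.measure_lt_top
  have hop : (lebOn K).IsOpenPosMeasure := by
    constructor
    rintro U hU ⟨x, hx⟩
    rw [lebOn, (MeasurableEmbedding.subtype_coe hKm).comap_apply]
    obtain ⟨V, hV, rfl⟩ := isOpen_induced_iff.1 hU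
    have hxc : (x : EuclideanSpace ℝ (Fin d)) ∈ closure (interior K) := hKreg ▸ x.2
    obtain ⟨z, hzV, hzK⟩ := mem_closure_iff.1 hxc V hV hx
    have := (hV.inter isOpen_interior).measure_pos volume ⟨z, hzV, hzK⟩
    refine (this.trans_le (measure_mono ?_)).ne'
    rintro w ⟨hw1, hw2⟩
    exact ⟨⟨w, interior_subset hw2⟩, hw1, rfl⟩
  obtain ⟨z, hz⟩ := hKint
  obtain ⟨l, hl0, ⟨ψ, hψ0, hψ1, hψe⟩, hmax⟩ := aux_main (lebOn K) P hPcont hPnonneg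
    ⟨z, interior_subset hz⟩ (hPpos _ _ hz hz) T hT
  have hTc := aux_compact (lebOn K) P hPcont T hT
  have hψne : ψ ≠ 0 := norm_pos_iff.1 (by rw [hψ1]; exact one_pos)
  have hint : ∀ f : K → ℝ, Continuous f → Integrable f (lebOn K) := fun f hf =>
    hf.integrable_of_hasCompactSupport (HasCompactSupport.of_compactSpace _)
  have hr : spectralRadius ℝ T = ENNReal.ofReal l := by
    apply le_antisymm
    · refine iSup₂_le fun k hk => ?_
      rw [← enorm_eq_nnnorm, ← ofReal_norm]
      refine ENNReal.ofReal_le_ofReal ?_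
      rcases eq_or_ne k 0 with rfl | hk0
      · simpa using hl0.le
      obtain ⟨φ, hφ⟩ := ((hTc.hasEigenvalue_iff_mem_spectrum hk0).2 hk).exists_hasEigenvector
      have hφe : T φ = k • φ := hφ.apply_eq_smul
      refine hmax ‖k‖ |φ| (fun x => by simp) (fun h => hφ.2 (by
        ext y
        simpa using DFunLike.congr_fun h y)) fun x => ?_
      rw [hT]
      have h1 : ‖k‖ * |φ| x = ‖T φ x‖ := by rw [hφe]; simp
      rw [h1, hT]
      refine (norm_integral_le_integral_norm _).trans (le_of_eq ?_)
      congr 1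
      ext y
      simp [abs_of_nonneg (hPnonneg x y)]
    · have hmem : l ∈ spectrum ℝ T := (hTc.hasEigenvalue_iff_mem_spectrum hl0.ne').1
        (Module.End.hasEigenvalue_of_hasEigenvector (x := ψ)
          ⟨Module.End.mem_eigenspace_iff.2 hψe, hψne⟩)
      refine le_trans (le_of_eq ?_) (le_iSup₂ (f := fun k (_ : k ∈ spectrum ℝ T) => (‖k‖₊ : ENNReal)) l hmem)
      rw [← enorm_eq_nnnorm, ← ofReal_norm, Real.norm_of_nonneg hl0.le]
  rw [hr, ENNReal.toReal_ofReal hl0.le]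
  refine ⟨hl0, ?_, ψ, hψne, hψ0, hψe⟩
  have h1 : ‖T ψ‖ ≤ 1 := by
    rw [ContinuousMap.norm_le _ zero_le_one]
    intro x
    rw [hT]
    refine (norm_integral_le_integral_norm _).trans (le_trans ?_ (hPsub x))
    refine integral_mono (hint _ (by fun_prop)) (hint _ (by fun_prop)) fun y => ?_
    have h2 := ψ.norm_coe_le_norm y
    rw [hψ1] at h2
    simp only [norm_mul, Real.norm_of_nonneg (hPnonneg x y)]
    exact mul_le_of_le_one_left (hPnonneg x y) h2
  rw [hψe, norm_smul, hψ1, mul_one, Real.norm_of_nonneg hl0.le] at h1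
  exact h1
end

section
/- The eigenspace of the integral operator T associated with its spectral radius r is one-dimensional: the set {φ ∈ C(K,ℝ) : Tφ = r·φ} is a linear subspace of dimension exactly one. -/
open MeasureTheory

section KR
set_option linter.unusedSectionVars false
open Filter Topology
variable {X : Type*} [MetricSpace X] [CompactSpace X] [Nonempty X] [MeasurableSpace X]
  [BorelSpace X]

theorem kr_int (μ : Measure X) [IsFiniteMeasure μ] {f : X → ℝ} (hf : Continuous f) :
    Integrable f μ :=
  hf.integrable_of_hasCompactSupport (HasCompactSupport.of_compactSpace f)

theorem kr_int_pos (μ : Measure X) [IsFiniteMeasure μ] [μ.IsOpenPosMeasure] {f : X → ℝ}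
    (hf : Continuous f) (h0 : ∀ x, 0 ≤ f x) {x : X} (hx : f x ≠ 0) : 0 < ∫ y, f y ∂μ :=
  hf.integral_pos_of_hasCompactSupport_nonneg_nonzero (HasCompactSupport.of_compactSpace f) h0 hx

/-- difference bound -/
theorem kr_diff (μ : Measure X) [IsFiniteMeasure μ] (P : C(X × X, ℝ)) (β : C(X, ℝ)) (x x' : X) :
    |(∫ y, β y * P (x, y) ∂μ) - ∫ y, β y * P (x', y) ∂μ| ≤
      ‖β‖ * dist (P.curry x) (P.curry x') * μ.real Set.univ := by
  rw [← integral_sub (kr_int μ (by fun_prop)) (kr_int μ (by fun_prop))]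
  rw [← Real.norm_eq_abs]
  refine norm_integral_le_of_norm_le_const (Eventually.of_forall fun y => ?_)
  rw [← mul_sub, norm_mul]
  gcongr
  · exact β.norm_coe_le_norm y
  · have := ContinuousMap.dist_apply_le_dist (f := P.curry x) (g := P.curry x') y
    simpa [Real.dist_eq] using this

theorem kr_bdd (μ : Measure X) [IsFiniteMeasure μ] (P : C(X × X, ℝ)) (β : C(X, ℝ)) (x : X) :
    ‖∫ y, β y * P (x, y) ∂μ‖ ≤ ‖β‖ * ‖P‖ * μ.real Set.univ := by
  refine norm_integral_le_of_norm_le_const (Eventually.of_forall fun y => ?_)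
  rw [norm_mul]
  gcongr
  · exact β.norm_coe_le_norm y
  · exact P.norm_coe_le_norm _

theorem kr_cont (μ : Measure X) [IsFiniteMeasure μ] (P : C(X × X, ℝ)) (β : C(X, ℝ)) :
    Continuous fun x => ∫ y, β y * P (x, y) ∂μ := by
  rw [continuous_iff_continuousAt]
  intro x
  rw [ContinuousAt, tendsto_iff_dist_tendsto_zero]
  refine squeeze_zero (fun _ => dist_nonneg) (fun x' => kr_diff μ P β x' x) ?_
  have : Tendsto (fun x' => dist (P.curry x') (P.curry x)) (𝓝 x) (𝓝 0) :=
    tendsto_iff_dist_tendsto_zero.1 (P.curry.continuous.tendsto x)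
  simpa using (this.const_mul ‖β‖).mul_const (μ.real Set.univ)

theorem kr_exists (μ : Measure X) [IsFiniteMeasure μ] (P : C(X × X, ℝ)) :
    ∃ T : C(X, ℝ) →L[ℝ] C(X, ℝ), ∀ β x, T β x = ∫ y, β y * P (x, y) ∂μ := by
  let L : C(X, ℝ) →ₗ[ℝ] C(X, ℝ) :=
    { toFun := fun β => ⟨_, kr_cont μ P β⟩
      map_add' := by
        intro a b
        ext x
        simp only [ContinuousMap.add_apply, ContinuousMap.coe_mk, add_mul]
        exact integral_add (kr_int μ (by fun_prop)) (kr_int μ (by fun_prop))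
      map_smul' := by
        intro a b
        ext x
        simp only [ContinuousMap.smul_apply, ContinuousMap.coe_mk, smul_eq_mul, mul_assoc,
          RingHom.id_apply]
        exact integral_const_mul _ _ }
  refine ⟨L.mkContinuous (‖P‖ * μ.real Set.univ) fun β => ?_, fun β x => rfl⟩
  rw [ContinuousMap.norm_le _ (by positivity)]
  intro x
  have := kr_bdd μ P β x
  calc _ ≤ _ := this
    _ = _ := by ring

theorem kr_compact (μ : Measure X) [IsFiniteMeasure μ] (P : C(X × X, ℝ))
    (T : C(X, ℝ) →L[ℝ] C(X, ℝ)) (hT : ∀ β x, T β x = ∫ y, β y * P (x, y) ∂μ) :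
    IsCompactOperator T := by
  set M := ‖P‖ * μ.real Set.univ
  let c : Set (X → ℝ) := {f | (∀ x, f x ∈ Set.Icc (-M) M) ∧
    ∀ x x', |f x - f x'| ≤ dist (P.curry x) (P.curry x') * μ.real Set.univ}
  have hlim : ∀ x, Tendsto (fun x' => dist (P.curry x) (P.curry x') * μ.real Set.univ)
      (𝓝 x) (𝓝 0) := by
    intro x
    have : Continuous fun x' => dist (P.curry x) (P.curry x') * μ.real Set.univ := by fun_prop
    simpa using this.tendsto x
  have hcc : IsCompact c := by
    have h1 : IsCompact (Set.univ.pi fun _ : X => Set.Icc (-M) M) :=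
      isCompact_univ_pi fun _ => isCompact_Icc
    refine h1.of_isClosed_subset ?_ fun f hf x _ => hf.1 x
    simp only [c, Set.ofPred_and, Set.ofPred_forall]
    refine IsClosed.inter (isClosed_iInter fun x => isClosed_Icc.preimage (continuous_apply x)) ?_
    refine isClosed_iInter fun x => isClosed_iInter fun x' => ?_
    exact isClosed_le (by fun_prop) continuous_const
  let S : Set C(X, ℝ) := {f | (f : X → ℝ) ∈ c}
  have hS : IsCompact S := by
    refine ArzelaAscoli.isCompact_of_equicontinuous S ?_ ?_
    · convert hcc
      ext f
      constructor
      · rintro ⟨g, hg, rfl⟩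
        exact hg
      · intro hf
        refine ⟨⟨f, ?_⟩, hf, rfl⟩
        rw [continuous_iff_continuousAt]
        intro x
        rw [ContinuousAt, tendsto_iff_dist_tendsto_zero]
        refine squeeze_zero (fun _ => dist_nonneg) (fun x' => ?_) (hlim x)
        rw [dist_comm]
        exact hf.2 x x'
    · intro x
      exact Metric.equicontinuousAt_of_continuity_modulus _ (hlim x) _
        (Eventually.of_forall fun x' f => f.2.2 x x')
  refine ⟨S, hS, ?_⟩
  refine mem_of_superset (Metric.closedBall_mem_nhds (0 : C(X, ℝ)) one_pos) fun β hβ => ?_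
  have hβ : ‖β‖ ≤ 1 := by simpa using hβ
  refine ⟨fun x => ?_, fun x x' => ?_⟩
  · have := kr_bdd μ P β x
    rw [hT, Set.mem_Icc, ← abs_le, ← Real.norm_eq_abs]
    refine this.trans ?_
    rw [mul_assoc]
    exact mul_le_of_le_one_left (by positivity) hβ
  · rw [hT, hT]
    refine (kr_diff μ P β x x').trans ?_
    rw [mul_assoc]
    exact mul_le_of_le_one_left (by positivity) hβ

theorem kr_nonneg (μ : Measure X) (P : C(X × X, ℝ))
    (T : C(X, ℝ) →L[ℝ] C(X, ℝ)) (hT : ∀ β x, T β x = ∫ y, β y * P (x, y) ∂μ)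
    (hP : ∀ z, 0 ≤ P z) (f : C(X, ℝ)) (hf : 0 ≤ f) : 0 ≤ T f := by
  rw [ContinuousMap.le_def]
  intro x
  rw [hT]
  exact integral_nonneg fun y => mul_nonneg (hf y) (hP _)

theorem kr_pos (μ : Measure X) [IsFiniteMeasure μ] [μ.IsOpenPosMeasure] (P : C(X × X, ℝ))
    (T : C(X, ℝ) →L[ℝ] C(X, ℝ)) (hT : ∀ β x, T β x = ∫ y, β y * P (x, y) ∂μ)
    (hP : ∀ z, 0 ≤ P z) (U : Set X) (hU : Dense U)
    (hPU : ∀ x ∈ U, ∀ y ∈ U, 0 < P (x, y)) (f : C(X, ℝ)) (hf : 0 ≤ f) (hf0 : f ≠ 0)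
    (x : X) (hx : x ∈ U) : 0 < T f x := by
  rw [hT]
  have : ∃ y ∈ U, f y ≠ 0 := by
    by_contra! h
    apply hf0
    apply DFunLike.coe_injective
    exact Continuous.ext_on hU f.continuous continuous_const h
  obtain ⟨y, hy, hfy⟩ := this
  exact kr_int_pos μ (by fun_prop) (fun y => mul_nonneg (hf y) (hP _))
    (x := y) (mul_ne_zero hfy (hPU x hx y hy).ne')

theorem kr_pair (μ : Measure X) [IsFiniteMeasure μ] (P Q : C(X × X, ℝ))
    (hPQ : ∀ x y, Q (x, y) = P (y, x))
    (T T' : C(X, ℝ) →L[ℝ] C(X, ℝ)) (hT : ∀ β x, T β x = ∫ y, β y * P (x, y) ∂μ)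
    (hT' : ∀ β x, T' β x = ∫ y, β y * Q (x, y) ∂μ) (f g : C(X, ℝ)) :
    ∫ x, T f x * g x ∂μ = ∫ x, f x * T' g x ∂μ := by
  simp_rw [hT, hT', ← integral_mul_const, ← integral_const_mul]
  rw [integral_integral_swap]
  · simp_rw [hPQ]
    congr! 4
    ring
  · exact Continuous.integrable_of_hasCompactSupport (by simp only [Function.uncurry_def]; fun_prop)
      (HasCompactSupport.of_compactSpace _)

theorem kr_norm_mono {f g : C(X, ℝ)} (hf : 0 ≤ f) (h : f ≤ g) : ‖f‖ ≤ ‖g‖ := by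
  rw [ContinuousMap.norm_le _ (norm_nonneg _)]
  intro x
  rw [Real.norm_of_nonneg (show 0 ≤ f x from hf x)]
  exact (h x).trans ((le_abs_self _).trans (g.norm_coe_le_norm x))

instance kr_oct : OrderClosedTopology C(X, ℝ) := by
  constructor
  have : {p : C(X, ℝ) × C(X, ℝ) | p.1 ≤ p.2} = ⋂ x, {p | p.1 x ≤ p.2 x} := by
    ext p
    simp [ContinuousMap.le_def]
  rw [this]
  exact isClosed_iInter fun x => isClosed_le
    ((continuous_eval_const x).comp continuous_fst)
    ((continuous_eval_const x).comp continuous_snd)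

/-- strictly positive kernels -/
theorem kr_strict (μ : Measure X) [IsFiniteMeasure μ] [μ.IsOpenPosMeasure] (P : C(X × X, ℝ))
    (T : C(X, ℝ) →L[ℝ] C(X, ℝ)) (hT : ∀ β x, T β x = ∫ y, β y * P (x, y) ∂μ)
    (hP : ∀ z, 0 < P z) :
    ∃ (l : ℝ) (g : C(X, ℝ)), 0 ≤ g ∧ ‖g‖ = 1 ∧ T g = l • g ∧
      ∀ (s : ℝ) (f : C(X, ℝ)), 0 ≤ f → f ≠ 0 → s • f ≤ T f → s ≤ l := by
  have hP0 : ∀ z, 0 ≤ P z := fun z => (hP z).le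
  have hmono : ∀ f g : C(X, ℝ), f ≤ g → T f ≤ T g := by
    intro f g h
    have := kr_nonneg μ P T hT hP0 (g - f) (sub_nonneg.2 h)
    rw [map_sub] at this
    exact sub_nonneg.1 this
  have hpos : ∀ f : C(X, ℝ), 0 ≤ f → f ≠ 0 → ∃ m > 0, ∀ x, m ≤ T f x := by
    intro f hf hf0
    obtain ⟨x, -, hx⟩ := isCompact_univ.exists_isMinOn (Set.univ_nonempty (α := X))
      (T f).continuous.continuousOn
    exact ⟨T f x, kr_pos μ P T hT hP0 Set.univ dense_univ (fun x _ y _ => hP _) f hf hf0 x trivial,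
      fun y => hx (Set.mem_univ y)⟩
  let S : Set ℝ := {s | ∃ f : C(X, ℝ), 0 ≤ f ∧ ‖f‖ = 1 ∧ s • f ≤ T f}
  have hSmem : ∀ (s : ℝ) (f : C(X, ℝ)), 0 ≤ f → f ≠ 0 → s • f ≤ T f → s ∈ S := by
    intro s f hf hf0 h
    have hn : 0 < ‖f‖ := norm_pos_iff.2 hf0
    refine ⟨‖f‖⁻¹ • f, smul_nonneg (by positivity) hf, ?_, ?_⟩
    · rw [norm_smul, norm_inv, norm_norm, inv_mul_cancel₀ hn.ne']
    · rw [map_smul, smul_comm]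
      exact smul_le_smul_of_nonneg_left h (by positivity)
  have hSb : BddAbove S := by
    refine ⟨‖T‖, ?_⟩
    rintro s ⟨f, hf, hf1, h⟩
    by_contra! hs
    have hs0 : 0 < s := (norm_nonneg T).trans_lt hs
    have h1 := kr_norm_mono (smul_nonneg hs0.le hf) h
    have h2 := T.le_opNorm f
    rw [norm_smul, hf1, Real.norm_of_nonneg hs0.le] at h1
    rw [hf1] at h2
    linarith
  obtain ⟨m1, hm1, hm1'⟩ := hpos 1 zero_le_one one_ne_zero
  have hm1S : m1 ∈ S := by
    refine hSmem m1 1 zero_le_one one_ne_zero ?_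
    rw [ContinuousMap.le_def]
    intro x
    simpa using hm1' x
  set l := sSup S with hl
  have hl0 : 0 < l := hm1.trans_le (le_csSup hSb hm1S)
  obtain ⟨s, -, hsl, hsS⟩ := exists_seq_tendsto_sSup ⟨m1, hm1S⟩ hSb
  choose f hf hf1 hsf using hsS
  obtain ⟨C, hC, hC'⟩ := (kr_compact μ P T hT).image_closedBall_subset_compact 1
  obtain ⟨h, -, ψ, hψ, hlim⟩ := hC.tendsto_subseq (x := fun n => T (f n))
    (fun n => hC' ⟨f n, by simp [hf1], rfl⟩)
  have hsl' := hsl.comp hψ.tendsto_atTop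
  have hh0 : 0 ≤ h := ge_of_tendsto' hlim fun n => kr_nonneg μ P T hT hP0 _ (hf _)
  have hhT : l • h ≤ T h := by
    refine le_of_tendsto_of_tendsto' (hsl'.smul hlim) ((T.continuous.tendsto h).comp hlim) ?_
    intro n
    have := hmono _ _ (hsf (ψ n))
    rwa [map_smul] at this
  have hhn : l ≤ ‖h‖ := by
    refine le_of_tendsto_of_tendsto' hsl' hlim.norm ?_
    intro n
    simp only [Function.comp]
    by_cases hs : 0 ≤ s (ψ n)
    · have := kr_norm_mono (smul_nonneg hs (hf _)) (hsf (ψ n))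
      rwa [norm_smul, hf1, Real.norm_of_nonneg hs, mul_one] at this
    · exact (not_le.1 hs).le.trans (norm_nonneg _)
  have hhne : h ≠ 0 := norm_pos_iff.1 (hl0.trans_le hhn)
  have heig : T h = l • h := by
    by_contra hne
    obtain ⟨m, hm, hm'⟩ := hpos (T h - l • h) (sub_nonneg.2 hhT) (sub_ne_zero.2 hne)
    have hlh : 0 ≤ l • h := smul_nonneg hl0.le hh0
    have hu0 : 0 ≤ T h := hlh.trans hhT
    have hune : T h ≠ 0 := by
      intro h0
      rw [h0] at hhT
      exact (smul_ne_zero hl0.ne' hhne) (le_antisymm hhT hlh)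
    have : l + m / (‖T h‖ + 1) ∈ S := by
      refine hSmem _ (T h) hu0 hune ?_
      rw [ContinuousMap.le_def]
      intro x
      have h1 := hm' x
      have h2 : T h x ≤ ‖T h‖ := (le_abs_self _).trans ((T h).norm_coe_le_norm x)
      have h3 : m / (‖T h‖ + 1) * T h x ≤ m := by
        rw [div_mul_eq_mul_div, div_le_iff₀ (by positivity)]
        exact mul_le_mul_of_nonneg_left (by linarith) hm.le
      simp only [map_sub, map_smul, ContinuousMap.sub_apply, ContinuousMap.smul_apply,
        smul_eq_mul] at h1 ⊢
      linarith
    have h4 := le_csSup hSb this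
    have : 0 < m / (‖T h‖ + 1) := by positivity
    linarith
  have hn : 0 < ‖h‖ := norm_pos_iff.2 hhne
  refine ⟨l, ‖h‖⁻¹ • h, smul_nonneg (by positivity) hh0, ?_, ?_, fun s f a b c =>
    le_csSup hSb (hSmem s f a b c)⟩
  · rw [norm_smul, norm_inv, norm_norm, inv_mul_cancel₀ hn.ne']
  · rw [map_smul, heig, smul_comm]

theorem kr_lower (μ : Measure X) [IsFiniteMeasure μ] [μ.IsOpenPosMeasure] (P : C(X × X, ℝ))
    (T : C(X, ℝ) →L[ℝ] C(X, ℝ)) (hT : ∀ β x, T β x = ∫ y, β y * P (x, y) ∂μ)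
    (hP : ∀ z, 0 ≤ P z) (u : X) (hu : 0 < P (u, u)) :
    ∃ c : ℝ, 0 < c ∧ ∃ f : C(X, ℝ), 0 ≤ f ∧ f ≠ 0 ∧ c • f ≤ T f := by
  have h1 : ∀ᶠ z in 𝓝 (u, u), P (u, u) / 2 < P z :=
    P.continuous.continuousAt.eventually (lt_mem_nhds (by linarith))
  obtain ⟨δ, hδ, h2⟩ := Metric.eventually_nhds_iff.1 h1
  set p := P (u, u) / 2 with hp
  have hp0 : 0 < p := by positivity
  let f : C(X, ℝ) := ⟨fun x => max 0 (δ - dist x u), by fun_prop⟩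
  have hf : 0 ≤ f := fun x => le_max_left _ _
  have hfu : f u ≠ 0 := by simp [f, hδ.ne', hδ.le]
  have hI : 0 < ∫ y, f y ∂μ := kr_int_pos μ f.continuous hf hfu
  refine ⟨p * (∫ y, f y ∂μ) / δ, by positivity, f, hf, ?_, ?_⟩
  · rintro h0
    rw [h0] at hfu
    exact hfu rfl
  · rw [ContinuousMap.le_def]
    intro x
    rw [ContinuousMap.smul_apply, smul_eq_mul]
    by_cases hx : dist x u < δ
    · have h3 : f x ≤ δ := max_le hδ.le (by linarith [dist_nonneg (x := x) (y := u)])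
      have h4 : p * (∫ y, f y ∂μ) / δ * f x ≤ p * ∫ y, f y ∂μ := by
        rw [div_mul_eq_mul_div, div_le_iff₀ hδ]
        gcongr
      refine h4.trans ?_
      rw [hT, ← integral_const_mul]
      refine integral_mono (kr_int μ (by fun_prop)) (kr_int μ (by fun_prop)) fun y => ?_
      show p * f y ≤ f y * P (x, y)
      by_cases hy : dist y u < δ
      · rw [mul_comm]
        refine mul_le_mul_of_nonneg_left (h2 ?_).le (hf y)
        rw [Prod.dist_eq]
        exact max_lt hx hy
      · have : f y = 0 := max_eq_left (by linarith)
        simp [this]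
    · have : f x = 0 := max_eq_left (by linarith)
      rw [this, mul_zero]
      exact kr_nonneg μ P T hT hP f hf x

theorem kr_eig (μ : Measure X) [IsFiniteMeasure μ] [μ.IsOpenPosMeasure] (P : C(X × X, ℝ))
    (T : C(X, ℝ) →L[ℝ] C(X, ℝ)) (hT : ∀ β x, T β x = ∫ y, β y * P (x, y) ∂μ)
    (hP : ∀ z, 0 ≤ P z) (u : X) (hu : 0 < P (u, u)) :
    ∃ (l : ℝ) (g : C(X, ℝ)), 0 < l ∧ 0 ≤ g ∧ g ≠ 0 ∧ T g = l • g := by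
  obtain ⟨c, hc, f, hf, hf0, hcf⟩ := kr_lower μ P T hT hP u hu
  obtain ⟨J, hJ⟩ := kr_exists μ (1 : C(X × X, ℝ))
  have key : ∀ n : ℕ, ∃ (l : ℝ) (g : C(X, ℝ)), 0 ≤ g ∧ ‖g‖ = 1 ∧
      T g + (1 / ((n : ℝ) + 1)) • J g = l • g ∧ c ≤ l := by
    intro n
    have hn : (0 : ℝ) < 1 / ((n : ℝ) + 1) := by positivity
    obtain ⟨l, g, h1, h2, h3, h4⟩ := kr_strict μ (P + (1 / ((n : ℝ) + 1)) • 1)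
      (T + (1 / ((n : ℝ) + 1)) • J) (by
        intro β x
        simp only [add_apply, smul_apply,
          ContinuousMap.add_apply, ContinuousMap.smul_apply, hT, hJ, smul_eq_mul, mul_add]
        rw [integral_add (kr_int μ (by fun_prop)) (kr_int μ (by fun_prop)), ← integral_const_mul]
        congr! 3
        ring) (by
        intro z
        have := hP z
        simp only [ContinuousMap.add_apply, ContinuousMap.smul_apply, ContinuousMap.one_apply,
          smul_eq_mul, mul_one]
        linarith)
    refine ⟨l, g, h1, h2, h3, h4 c f hf hf0 (hcf.trans ?_)⟩
    have := kr_nonneg μ 1 J hJ (fun z => zero_le_one) f hf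
    simp only [add_apply, smul_apply]
    exact le_add_of_nonneg_right (smul_nonneg hn.le this)
  choose l g hg hg1 heq hcl using key
  have hlb : ∀ n, l n ∈ Set.Icc c (‖T‖ + ‖J‖) := by
    intro n
    refine ⟨hcl n, ?_⟩
    have hn : 1 / ((n : ℝ) + 1) ≤ 1 := by
      rw [div_le_one (by positivity)]
      linarith [Nat.cast_nonneg (α := ℝ) n]
    have h1 : ‖l n • g n‖ = l n := by
      rw [norm_smul, hg1, mul_one, Real.norm_of_nonneg (hc.le.trans (hcl n))]
    rw [← h1, ← heq]
    have h2 := T.le_opNorm (g n)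
    have h3 := J.le_opNorm (g n)
    rw [hg1, mul_one] at h2 h3
    refine (norm_add_le _ _).trans (add_le_add h2 ?_)
    rw [norm_smul, Real.norm_of_nonneg (by positivity)]
    exact (mul_le_of_le_one_left (norm_nonneg _) hn).trans h3
  obtain ⟨C, hC, hC'⟩ := (kr_compact μ P T hT).image_closedBall_subset_compact 1
  obtain ⟨⟨L, h⟩, hmem, ψ, hψ, hlim⟩ := (isCompact_Icc.prod hC).tendsto_subseq
    (x := fun n => (l n, T (g n)))
    (fun n => ⟨hlb n, hC' ⟨g n, by simp [hg1], rfl⟩⟩)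
  rw [Prod.tendsto_iff] at hlim
  obtain ⟨hL, hh⟩ := hlim
  simp only [Function.comp_def] at hL hh
  have hL0 : 0 < L := hc.trans_le hmem.1.1
  have hJ0 : Tendsto (fun n => (1 / ((ψ n : ℝ) + 1)) • J (g (ψ n))) atTop (𝓝 0) := by
    have h0 : Tendsto (fun n => (1 / ((ψ n : ℝ) + 1)) * ‖J‖) atTop (𝓝 0) := by
      simpa using (tendsto_one_div_add_atTop_nhds_zero_nat.comp hψ.tendsto_atTop).mul_const ‖J‖
    refine squeeze_zero_norm (fun n => ?_) h0
    rw [norm_smul, Real.norm_of_nonneg (by positivity)]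
    have h3 := J.le_opNorm (g (ψ n))
    rw [hg1, mul_one] at h3
    gcongr
  have hlg : Tendsto (fun n => l (ψ n) • g (ψ n)) atTop (𝓝 h) := by
    simp_rw [← heq]
    simpa using hh.add hJ0
  refine ⟨L, h, hL0, ?_, ?_, ?_⟩
  · exact ge_of_tendsto' hh fun n => kr_nonneg μ P T hT hP _ (hg _)
  · have : ‖h‖ = L := by
      refine tendsto_nhds_unique hlg.norm ?_
      convert hL using 2 with n
      rw [norm_smul, hg1, mul_one, Real.norm_of_nonneg (hc.le.trans (hcl _))]
    rw [← norm_pos_iff, this]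
    exact hL0
  · refine tendsto_nhds_unique ((T.continuous.tendsto h).comp hlg) ?_
    simp only [Function.comp_def, map_smul]
    exact hL.smul hh

theorem kr_main (μ : Measure X) [IsFiniteMeasure μ] [μ.IsOpenPosMeasure] (P : C(X × X, ℝ))
    (T : C(X, ℝ) →L[ℝ] C(X, ℝ)) (hT : ∀ β x, T β x = ∫ y, β y * P (x, y) ∂μ)
    (hP : ∀ z, 0 ≤ P z) (U : Set X) (hU : Dense U)
    (hPU : ∀ x ∈ U, ∀ y ∈ U, 0 < P (x, y)) :
    ∃ E : Submodule ℝ C(X, ℝ),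
      (E : Set C(X, ℝ)) = {φ : C(X, ℝ) | T φ = (spectralRadius ℝ T).toReal • φ} ∧
      Module.finrank ℝ ↥E = 1 := by
  obtain ⟨u, hu⟩ := hU.nonempty
  let Q : C(X × X, ℝ) := ⟨fun z => P (z.2, z.1), by fun_prop⟩
  obtain ⟨T', hT'⟩ := kr_exists μ Q
  obtain ⟨l, φ, hl, hφ, hφ0, hTφ⟩ := kr_eig μ P T hT hP u (hPU u hu u hu)
  obtain ⟨m, ψ, hm, hψ, hψ0, hTψ⟩ := kr_eig μ Q T' hT' (fun z => hP _) u (hPU u hu u hu)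
  have hpair : ∀ f : C(X, ℝ), ∫ x, T f x * ψ x ∂μ = m * ∫ x, f x * ψ x ∂μ := by
    intro f
    rw [kr_pair μ P Q (fun _ _ => rfl) T T' hT hT' f ψ, hTψ, ← integral_const_mul]
    congr! 2 with x
    simp only [ContinuousMap.smul_apply, smul_eq_mul]
    ring
  have hψU : ∀ x ∈ U, 0 < ψ x := by
    intro x hx
    have := kr_pos μ Q T' hT' (fun z => hP _) U hU (fun x hx y hy => hPU y hy x hx) ψ hψ hψ0 x hx
    rw [hTψ, ContinuousMap.smul_apply, smul_eq_mul] at this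
    exact pos_of_mul_pos_right this hm.le
  have hposU : ∀ f : C(X, ℝ), 0 ≤ f → f ≠ 0 → T f = l • f → ∀ x ∈ U, 0 < f x := by
    intro f hf hf0 h x hx
    have := kr_pos μ P T hT hP U hU hPU f hf hf0 x hx
    rw [h, ContinuousMap.smul_apply, smul_eq_mul] at this
    exact pos_of_mul_pos_right this hl.le
  have hext : ∀ f : C(X, ℝ), (∀ x ∈ U, f x = 0) → f = 0 := by
    intro f h
    apply DFunLike.coe_injective
    exact Continuous.ext_on hU f.continuous continuous_const h
  have hint : ∀ f : C(X, ℝ), 0 ≤ f → f ≠ 0 → 0 < ∫ x, f x * ψ x ∂μ := by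
    intro f hf hf0
    have : ∃ x ∈ U, f x ≠ 0 := by
      by_contra! h
      exact hf0 (hext f h)
    obtain ⟨x, hx, hfx⟩ := this
    exact kr_int_pos μ (by fun_prop) (fun y => mul_nonneg (hf y) (hψ y))
      (mul_ne_zero hfx (hψU x hx).ne')
  have hcomp : ∀ (s : ℝ) (f : C(X, ℝ)), 0 ≤ f → f ≠ 0 → s • f ≤ T f → s ≤ m := by
    intro s f hf hf0 h
    have h1 : ∫ x, (s * (f x * ψ x)) ∂μ ≤ ∫ x, T f x * ψ x ∂μ := by
      refine integral_mono (kr_int μ (by fun_prop)) (kr_int μ (by fun_prop)) fun x => ?_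
      have h2 : s * f x ≤ T f x := h x
      have := mul_le_mul_of_nonneg_right h2 (hψ x)
      simp only [← mul_assoc]
      exact this
    rw [hpair, integral_const_mul] at h1
    exact le_of_mul_le_mul_right h1 (hint f hf hf0)
  have hlm : l = m := by
    have h := hpair φ
    have h1 : ∫ x, T φ x * ψ x ∂μ = l * ∫ x, φ x * ψ x ∂μ := by
      rw [hTφ, ← integral_const_mul]
      congr! 2 with x
      simp only [ContinuousMap.smul_apply, smul_eq_mul]
      ring
    rw [h1] at h
    exact mul_right_cancel₀ (hint φ hφ hφ0).ne' h
  subst hlm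
  have habs : ∀ (s : ℝ) (f : C(X, ℝ)), T f = s • f → |s| • |f| ≤ T |f| := by
    intro s f h
    rw [ContinuousMap.le_def]
    intro x
    rw [ContinuousMap.smul_apply, smul_eq_mul, ContinuousMap.abs_apply, ← abs_mul]
    have h1 : s * f x = T f x := by rw [h]; rfl
    rw [h1, hT, hT]
    refine (abs_integral_le_integral_abs).trans (le_of_eq ?_)
    congr! 2 with y
    rw [abs_mul, abs_of_nonneg (hP _), ContinuousMap.abs_apply]
  have habs0 : ∀ f : C(X, ℝ), f ≠ 0 → |f| ≠ 0 := by
    intro f hf h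
    apply hf
    ext x
    have h1 := DFunLike.congr_fun h x
    rw [ContinuousMap.abs_apply] at h1
    exact abs_eq_zero.1 h1
  have hspec : ∀ s ∈ spectrum ℝ T, |s| ≤ l := by
    intro s hs
    by_cases hs0 : s = 0
    · simp [hs0, hl.le]
    rw [← (kr_compact μ P T hT).hasEigenvalue_iff_mem_spectrum hs0] at hs
    obtain ⟨f, hf⟩ := hs.exists_hasEigenvector
    exact hcomp _ _ (abs_nonneg f) (habs0 f hf.2) (habs s f hf.apply_eq_smul)
  have hmem : l ∈ spectrum ℝ T := by
    rw [← (kr_compact μ P T hT).hasEigenvalue_iff_mem_spectrum hl.ne']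
    exact Module.End.hasEigenvalue_of_hasEigenvector
      (x := φ) (Module.End.hasEigenvector_iff.2 ⟨Module.End.mem_eigenspace_iff.2 hTφ, hφ0⟩)
  have hrad : spectralRadius ℝ T = ENNReal.ofReal l := by
    apply le_antisymm
    · refine iSup₂_le fun s hs => ?_
      have h1 := hspec s hs
      rw [← enorm_eq_nnnorm, ← ofReal_norm]
      exact ENNReal.ofReal_le_ofReal h1
    · refine le_trans (le_of_eq ?_)
        (le_iSup₂ (f := fun k (_ : k ∈ spectrum ℝ T) => (‖k‖₊ : ENNReal)) l hmem)
      rw [← enorm_eq_nnnorm, ← ofReal_norm, Real.norm_of_nonneg hl.le]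
  rw [hrad, ENNReal.toReal_ofReal hl.le]
  refine ⟨Module.End.eigenspace (T : Module.End ℝ C(X, ℝ)) l, ?_, ?_⟩
  · ext f
    exact Module.End.mem_eigenspace_iff
  have hφE : φ ∈ Module.End.eigenspace (T : Module.End ℝ C(X, ℝ)) l :=
    Module.End.mem_eigenspace_iff.2 hTφ
  have hzero : ∀ f : C(X, ℝ), T f = l • f → f u = 0 → f = 0 := by
    intro f hf hfu
    by_contra hf0
    have h1 := habs l f hf
    rw [abs_of_pos hl] at h1
    have h2 : T |f| = l • |f| := by
      by_contra hne
      have h3 := hint (T |f| - l • |f|) (sub_nonneg.2 h1) (sub_ne_zero.2 hne)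
      have h4 : ∫ x, (T |f| - l • |f|) x * ψ x ∂μ =
          (∫ x, T |f| x * ψ x ∂μ) - l * ∫ x, |f| x * ψ x ∂μ := by
        rw [← integral_const_mul, ← integral_sub (kr_int μ (by fun_prop)) (kr_int μ (by fun_prop))]
        congr! 2 with x
        simp only [ContinuousMap.sub_apply, ContinuousMap.smul_apply, smul_eq_mul]
        ring
      rw [h4, hpair, sub_self] at h3
      exact lt_irrefl _ h3
    have h5 := hposU |f| (abs_nonneg f) (habs0 f hf0) h2 u hu
    rw [ContinuousMap.abs_apply, hfu, abs_zero] at h5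
    exact lt_irrefl _ h5
  refine finrank_eq_one (⟨φ, hφE⟩ : Module.End.eigenspace (T : Module.End ℝ C(X, ℝ)) l) ?_ ?_
  · intro h
    exact hφ0 (congrArg Subtype.val h)
  · rintro ⟨f, hf⟩
    have hf : T f = l • f := Module.End.mem_eigenspace_iff.1 hf
    have hφu := hposU φ hφ hφ0 hTφ u hu
    refine ⟨f u / φ u, Subtype.ext ?_⟩
    have := hzero ((f u / φ u) • φ - f) (by rw [map_sub, map_smul, hf, hTφ, smul_sub, smul_comm])
      (by simp [hφu.ne'])
    exact sub_eq_zero.1 this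

end KR

/-- The eigenspace of the integral operator `T` associated with its spectral radius is a
linear subspace of dimension exactly one. -/
theorem stmt_5 {d : ℕ} (K : Set (EuclideanSpace ℝ (Fin d)))
    [Nonempty ↥K] [CompactSpace ↥K]
    (hKint : (interior K).Nonempty) (hKreg : K = closure (interior K))
    (P : ↥K × ↥K → ℝ) (hPcont : Continuous P)
    (hPnonneg : ∀ x y : ↥K, 0 ≤ P (x, y))
    (hPpos : ∀ x y : ↥K, (x : EuclideanSpace ℝ (Fin d)) ∈ interior K →
      (y : EuclideanSpace ℝ (Fin d)) ∈ interior K → 0 < P (x, y))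
    (hPsub : ∀ x : ↥K, ∫ y : ↥K, P (x, y) ∂(lebOn K) ≤ 1)
    (T : C(↥K, ℝ) →L[ℝ] C(↥K, ℝ))
    (hT : ∀ (β : C(↥K, ℝ)) (x : ↥K), T β x = ∫ y : ↥K, β y * P (x, y) ∂(lebOn K)) :
    ∃ E : Submodule ℝ C(↥K, ℝ),
      (E : Set C(↥K, ℝ)) = {φ : C(↥K, ℝ) | T φ = (spectralRadius ℝ T).toReal • φ} ∧
      Module.finrank ℝ ↥E = 1 := by
  have hKc : IsCompact K := isCompact_iff_compactSpace.2 inferInstance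
  have hemb : MeasurableEmbedding (Subtype.val : ↥K → EuclideanSpace ℝ (Fin d)) :=
    MeasurableEmbedding.subtype_coe hKc.measurableSet
  have hU : Dense (Subtype.val ⁻¹' interior K : Set ↥K) := by
    rw [dense_iff_inter_open]
    rintro V hV ⟨x, hx⟩
    obtain ⟨W, hW, rfl⟩ := isOpen_induced_iff.1 hV
    have hxc : (x : EuclideanSpace ℝ (Fin d)) ∈ closure (interior K) := hKreg ▸ x.2
    obtain ⟨y, hyW, hyK⟩ := mem_closure_iff.1 hxc W hW hx
    exact ⟨⟨y, interior_subset hyK⟩, hyW, hyK⟩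
  have : IsFiniteMeasure (lebOn K) := by
    constructor
    rw [lebOn, hemb.comap_apply, Set.image_univ, Subtype.range_coe]
    exact hKc.measure_lt_top
  have : (lebOn K).IsOpenPosMeasure := by
    constructor
    intro V hV hne
    obtain ⟨x, hxV, hxU⟩ := hU.inter_open_nonempty V hV hne
    obtain ⟨W, hW, rfl⟩ := isOpen_induced_iff.1 hV
    rw [lebOn, hemb.comap_apply]
    have h1 : W ∩ interior K ⊆ Subtype.val '' (Subtype.val ⁻¹' W : Set ↥K) := by
      rintro y ⟨hy, hyK⟩
      exact ⟨⟨y, interior_subset hyK⟩, hy, rfl⟩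
    have h2 : 0 < volume (W ∩ interior K) :=
      (hW.inter isOpen_interior).measure_pos volume ⟨x, hxV, hxU⟩
    exact (h2.trans_le (measure_mono h1)).ne'
  exact kr_main (lebOn K) ⟨P, hPcont⟩ T hT (fun z => hPnonneg z.1 z.2) _ hU
    (fun x hx y hy => hPpos x y hx hy)
end

section
/- If f ∈ C(K,ℝ) satisfies f(x) ≥ 0 for all x ∈ K, f is not identically zero, and (Tf)(x) ≥ r·f(x) for all x ∈ K, where r is the spectral radius of T, then Tf = r·f. -/
open MeasureTheory

section helpers

variable {X : Type*} [TopologicalSpace X] [CompactSpace X]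

lemma aux_app {a b : C(X, ℝ)} (h : a ≤ b) (x : X) : a x ≤ b x := h x

lemma aux_app0 {b : C(X, ℝ)} (h : 0 ≤ b) (x : X) : 0 ≤ b x := h x

lemma aux_norm (b : C(X, ℝ)) (x : X) : b x ≤ ‖b‖ :=
  (le_abs_self _).trans (ContinuousMap.norm_coe_le_norm b x)

lemma aux_cont {E : Type*} [NormedAddCommGroup E] [NormedSpace ℝ E] [CompleteSpace E]
    (T : E →L[ℝ] E) (l : ℝ) (hl : l ∈ resolventSet ℝ T) (u : E) :
    ContinuousAt (fun m => resolvent T m u) l := by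
  have h : ContinuousAt (resolvent T) l :=
    (spectrum.hasDerivAt_resolvent_const_left hl).continuousAt
  exact (ContinuousLinearMap.apply ℝ E u).continuous.continuousAt.comp h

lemma aux_spec {E : Type*} [NormedAddCommGroup E] [NormedSpace ℝ E] [CompleteSpace E]
    [Nontrivial E] (T : E →L[ℝ] E) (l : ℝ) (hl : (spectralRadius ℝ T).toReal < l) :
    l ∈ resolventSet ℝ T := by
  have hfin : spectralRadius ℝ T ≠ ⊤ :=
    (lt_of_le_of_lt (spectrum.spectralRadius_le_nnnorm T) ENNReal.coe_lt_top).ne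
  apply spectrum.mem_resolventSet_of_spectralRadius_lt
  have hl0 : 0 ≤ l := ENNReal.toReal_nonneg.trans hl.le
  rw [← ENNReal.toReal_lt_toReal hfin ENNReal.coe_ne_top]
  simpa [abs_of_nonneg hl0] using hl

lemma aux_neumann (A : C(X, ℝ) →L[ℝ] C(X, ℝ))
    (hA : ∀ u : C(X, ℝ), 0 ≤ u → 0 ≤ A u) (q : ℝ) (hq0 : 0 ≤ q) (hq : q < 1)
    (hn : ∀ v, ‖A v‖ ≤ q * ‖v‖)
    (v : C(X, ℝ)) (hv : A v ≤ v) : 0 ≤ v := by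
  have hmono : ∀ a b : C(X, ℝ), a ≤ b → A a ≤ A b := by
    intro a b hab
    have := hA (b - a) (sub_nonneg.2 hab)
    rw [map_sub] at this
    exact sub_nonneg.1 this
  have hit : ∀ n : ℕ, (A ^ n) v ≤ v ∧ ‖(A ^ n) v‖ ≤ q ^ n * ‖v‖ := by
    intro n
    induction n with
    | zero => simp
    | succ n ih =>
      rw [pow_succ']
      refine ⟨(hmono _ _ ih.1).trans hv, ?_⟩
      calc ‖A ((A ^ n) v)‖ ≤ q * ‖(A ^ n) v‖ := hn _
          _ ≤ q * (q ^ n * ‖v‖) := mul_le_mul_of_nonneg_left ih.2 hq0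
          _ = q ^ (n + 1) * ‖v‖ := by ring
  have h2 : Filter.Tendsto (fun n : ℕ => -(q ^ n * ‖v‖)) Filter.atTop (nhds 0) := by
    have := ((tendsto_pow_atTop_nhds_zero_of_lt_one hq0 hq).mul_const ‖v‖).neg
    simpa using this
  refine ContinuousMap.le_def.2 fun x => ?_
  refine le_of_tendsto h2 (Filter.Eventually.of_forall fun n => ?_)
  have h3 := aux_app (hit n).1 x
  have h4 := (neg_le_abs _).trans (ContinuousMap.norm_coe_le_norm ((A ^ n) v) x)
  linarith [(hit n).2]

lemma aux_res (T : C(X, ℝ) →L[ℝ] C(X, ℝ)) (l : ℝ) (hl : l ∈ resolventSet ℝ T)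
    (v : C(X, ℝ)) : resolvent T l (l • v - T v) = v := by
  have h : resolvent T l * (algebraMap ℝ (C(X, ℝ) →L[ℝ] C(X, ℝ)) l - T) = 1 :=
    Ring.inverse_mul_cancel _ hl
  have := congrArg (fun L : C(X, ℝ) →L[ℝ] C(X, ℝ) => L v) h
  simpa [Algebra.algebraMap_eq_smul_one] using this

lemma aux_res' (T : C(X, ℝ) →L[ℝ] C(X, ℝ)) (l : ℝ) (hl : l ∈ resolventSet ℝ T)
    (v : C(X, ℝ)) : l • resolvent T l v - T (resolvent T l v) = v := by
  have h : (algebraMap ℝ (C(X, ℝ) →L[ℝ] C(X, ℝ)) l - T) * resolvent T l = 1 :=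
    Ring.mul_inverse_cancel _ hl
  have := congrArg (fun L : C(X, ℝ) →L[ℝ] C(X, ℝ) => L v) h
  simpa [Algebra.algebraMap_eq_smul_one] using this

lemma aux_step (T : C(X, ℝ) →L[ℝ] C(X, ℝ)) (l0 l : ℝ)
    (h0 : l0 ∈ resolventSet ℝ T) (h : l ∈ resolventSet ℝ T) (hll : l ≤ l0)
    (hpos : ∀ u : C(X, ℝ), 0 ≤ u → 0 ≤ resolvent T l0 u)
    (hsmall : (l0 - l) * ‖resolvent T l0‖ < 1) :
    ∀ u : C(X, ℝ), 0 ≤ u → 0 ≤ resolvent T l u := by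
  intro u hu
  set v := resolvent T l u with hv
  have h1 : l • v - T v = u := aux_res' T l h u
  refine aux_neumann ((l0 - l) • resolvent T l0) ?_ ((l0 - l) * ‖resolvent T l0‖)
    (mul_nonneg (sub_nonneg.2 hll) (ContinuousLinearMap.opNorm_nonneg _)) hsmall ?_ v ?_
  · intro w hw
    exact smul_nonneg (sub_nonneg.2 hll) (hpos w hw)
  · intro w
    change ‖(l0 - l) • resolvent T l0 w‖ ≤ _
    rw [norm_smul, Real.norm_of_nonneg (sub_nonneg.2 hll), mul_assoc]
    exact mul_le_mul_of_nonneg_left ((resolvent T l0).le_opNorm w) (sub_nonneg.2 hll)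
  · have h2 := hpos u hu
    have h3 : u = (l0 • v - T v) - (l0 - l) • v := by
      rw [← h1, sub_smul]; abel
    rw [h3, map_sub, aux_res T l0 h0, map_smul] at h2
    exact sub_nonneg.1 h2

lemma aux_pos (T : C(X, ℝ) →L[ℝ] C(X, ℝ)) (hT : ∀ u : C(X, ℝ), 0 ≤ u → 0 ≤ T u)
    (r : ℝ) (hr0 : 0 ≤ r) (hr : ∀ l, r < l → l ∈ resolventSet ℝ T) (l : ℝ) (hl : r < l) :
    ∀ u : C(X, ℝ), 0 ≤ u → 0 ≤ resolvent T l u := by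
  set M : ℝ := l + ‖T‖ with hM
  have hlM : l ≤ M := by rw [hM]; linarith [ContinuousLinearMap.opNorm_nonneg T]
  let S : Set ℝ := {t | ∀ u : C(X, ℝ), 0 ≤ u → 0 ≤ resolvent T (-t) u}
  have key : Set.Icc (-M) (-l) ⊆ S := by
    apply IsClosed.Icc_subset_of_forall_mem_nhdsWithin
    · rw [← isSeqClosed_iff_isClosed]
      intro x p hx hp
      have hpI : p ∈ Set.Icc (-M) (-l) := isClosed_Icc.mem_of_tendsto hp
        (Filter.Eventually.of_forall fun n => (hx n).2)
      refine ⟨fun u hu => ContinuousMap.le_def.2 fun y => ?_, hpI⟩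
      have hc : Filter.Tendsto (fun n => resolvent T (-(x n)) u) Filter.atTop
          (nhds (resolvent T (-p) u)) :=
        (aux_cont T (-p) (hr _ (by linarith [hpI.2])) u).tendsto.comp hp.neg
      have hc2 : Filter.Tendsto (fun n => resolvent T (-(x n)) u y) Filter.atTop
          (nhds (resolvent T (-p) u y)) :=
        ((ContinuousEvalConst.continuous_eval_const y).tendsto _).comp hc
      exact ge_of_tendsto hc2 (Filter.Eventually.of_forall fun n => aux_app0 ((hx n).1 u hu) y)
    · intro u hu
      rw [neg_neg]
      have hMpos : 0 < M := by linarith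
      refine aux_neumann (M⁻¹ • T) ?_ (M⁻¹ * ‖T‖)
        (mul_nonneg (inv_nonneg.2 hMpos.le) (ContinuousLinearMap.opNorm_nonneg T)) ?_ ?_ _ ?_
      · intro w hw
        exact smul_nonneg (inv_nonneg.2 hMpos.le) (hT w hw)
      · rw [inv_mul_lt_iff₀ hMpos]
        linarith
      · intro w
        change ‖M⁻¹ • T w‖ ≤ _
        rw [norm_smul, Real.norm_of_nonneg (by positivity), mul_assoc]
        exact mul_le_mul_of_nonneg_left (T.le_opNorm w) (by positivity)
      · have h1 := aux_res' T M (hr M (by linarith)) u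
        set v := resolvent T M u
        have : v - (M⁻¹ • T) v = M⁻¹ • u := by
          rw [← h1, smul_sub, smul_smul, inv_mul_cancel₀ hMpos.ne', one_smul]; rfl
        apply sub_nonneg.1
        rw [this]
        exact smul_nonneg (by positivity) hu
    · intro t ht
      have ht1 : t ∈ S := ht.1
      have h1 : ∀ᶠ s in nhdsWithin t (Set.Ioi t), (-t - (-s)) * ‖resolvent T (-t)‖ < 1 := by
        apply Filter.Eventually.filter_mono nhdsWithin_le_nhds
        have : Continuous fun s : ℝ => (-t - (-s)) * ‖resolvent T (-t)‖ := by fun_prop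
        exact this.continuousAt.eventually_lt continuousAt_const (by simp)
      have h2 : ∀ᶠ s in nhdsWithin t (Set.Ioi t), s < -l :=
        Filter.Eventually.filter_mono nhdsWithin_le_nhds (eventually_lt_nhds ht.2.2)
      filter_upwards [h1, h2, self_mem_nhdsWithin] with s hs1 hs2 hs3
      have hs3' : t < s := hs3
      exact aux_step T (-t) (-s) (hr _ (by linarith [ht.2.2])) (hr _ (by linarith))
        (by linarith) ht1 hs1
  have := key (Set.right_mem_Icc.2 (neg_le_neg hlM))
  simpa [S] using this

/-- abstract main argument -/
lemma aux_main_s7 (T : C(X, ℝ) →L[ℝ] C(X, ℝ)) (hT : ∀ u : C(X, ℝ), 0 ≤ u → 0 ≤ T u)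
    (r : ℝ) (hr0 : 0 ≤ r) (hr : ∀ l, r < l → l ∈ resolventSet ℝ T)
    (hirr : ∀ u : C(X, ℝ), 0 ≤ u → u ≠ 0 → ∀ x, 0 < T 1 x → 0 < T (T u) x)
    (hT1 : ∃ x, 0 < T 1 x)
    (f : C(X, ℝ)) (hf : 0 ≤ f) (hf0 : f ≠ 0) (hsup : r • f ≤ T f) : T f = r • f := by
  have hpos := aux_pos T hT r hr0 hr
  have hcompact : ∀ u : C(X, ℝ), 0 ≤ u → u ≠ 0 → ∀ δ > 0, ∃ c > 0, ∀ x, δ ≤ T 1 x →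
      c ≤ T (T u) x := by
    intro u hu hu0 δ hδ
    have hc : IsCompact {x | δ ≤ T 1 x} :=
      (isClosed_le continuous_const (T 1).continuous).isCompact
    rcases Set.eq_empty_or_nonempty {x | δ ≤ T 1 x} with he | hne
    · refine ⟨1, one_pos, fun x hx => ?_⟩
      have : x ∈ {x | δ ≤ T 1 x} := hx
      simp [he] at this
    · obtain ⟨x0, hx0, hmin⟩ := hc.exists_isMinOn hne (T (T u)).continuous.continuousOn
      exact ⟨T (T u) x0, hirr u hu hu0 x0 (lt_of_lt_of_le hδ hx0), fun x hx => hmin hx⟩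
  have hmono : ∀ l, r < l → ∀ a b : C(X, ℝ), a ≤ b → resolvent T l a ≤ resolvent T l b := by
    intro l hl a b hab
    have := hpos l hl (b - a) (sub_nonneg.2 hab)
    rw [map_sub] at this
    exact sub_nonneg.1 this
  have hRT : ∀ l, r < l → ∀ u, resolvent T l (T u) = l • resolvent T l u - u := by
    intro l hl u
    have := aux_res T l (hr l hl) u
    rw [map_sub, map_smul] at this
    rw [← sub_eq_zero]; rw [← sub_eq_zero] at this
    rw [← neg_eq_zero, ← this]; abel
  have hRTT : ∀ l, r < l → ∀ u : C(X, ℝ), 0 ≤ u → ∀ x, resolvent T l (T (T u)) x ≤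
      l ^ 2 * resolvent T l u x := by
    intro l hl u hu x
    have hl0 : 0 < l := lt_of_le_of_lt hr0 hl
    rw [hRT l hl, hRT l hl]
    have h1 := aux_app0 hu x
    have h2 := aux_app0 (hT u hu) x
    simp only [ContinuousMap.sub_apply, ContinuousMap.smul_apply, smul_eq_mul,
      ContinuousMap.zero_apply] at *
    nlinarith
  -- r > 0
  have hrpos : 0 < r := by
    by_contra hcon
    have hr00 : r = 0 := le_antisymm (not_lt.1 hcon) hr0
    obtain ⟨x0, hx0⟩ := hT1
    set δ := T 1 x0 / 2 with hδ
    have hδpos : 0 < δ := by positivity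
    let u : C(X, ℝ) := (T 1 - ContinuousMap.const X δ) ⊔ 0
    have hux : ∀ x, u x = max (T 1 x - δ) 0 := fun x => by simp [u]
    have hu : 0 ≤ u := le_sup_right
    have hux0 : 0 < u x0 := by
      rw [hux]; apply lt_max_of_lt_left; linarith
    have hu0 : u ≠ 0 := by
      intro h; rw [h] at hux0; simp at hux0
    obtain ⟨c, hc, hcx⟩ := hcompact u hu hu0 δ hδpos
    set a := c / (‖u‖ + 1) with ha
    have hapos : 0 < a := by positivity
    have hau : a • u ≤ T (T u) := by
      refine ContinuousMap.le_def.2 fun x => ?_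
      have hTT := aux_app0 (hT _ (hT u hu)) x
      simp only [ContinuousMap.smul_apply, smul_eq_mul]
      by_cases hx : δ ≤ T 1 x
      · refine le_trans ?_ (hcx x hx)
        have : u x ≤ ‖u‖ := aux_norm u x
        rw [ha, div_mul_eq_mul_div, div_le_iff₀ (by positivity)]
        nlinarith
      · have : u x = 0 := by rw [hux]; exact max_eq_right (by linarith)
        rw [this, mul_zero]; exact hTT
    set l := Real.sqrt (a / 2) with hl
    have hlpos : 0 < l := Real.sqrt_pos.2 (by positivity)
    have hlr : r < l := by rw [hr00]; exact hlpos
    have hl2 : l ^ 2 = a / 2 := Real.sq_sqrt (by positivity)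
    have h1 := aux_app (hmono l hlr _ _ hau) x0
    have h2 := hRTT l hlr u hu x0
    have h3 := congrArg (fun g : C(X, ℝ) => g x0) (hRT l hlr u)
    have h4 := aux_app0 (hpos l hlr (T u) (hT u hu)) x0
    rw [map_smul] at h1
    simp only [ContinuousMap.sub_apply, ContinuousMap.smul_apply, smul_eq_mul,
      ContinuousMap.zero_apply] at h1 h2 h3 h4
    have h5 : 0 < resolvent T l u x0 := by
      by_contra hneg
      push Not at hneg
      nlinarith
    rw [hl2] at h2
    nlinarith
  by_contra hne
  set h : C(X, ℝ) := T f - r • f with hh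
  have hh0 : 0 ≤ h := sub_nonneg.2 hsup
  have hhne : h ≠ 0 := fun h0 => hne (sub_eq_zero.1 h0)
  obtain ⟨c, hc, hcx⟩ := hcompact h hh0 hhne (r / 2) (by positivity)
  set C : ℝ := ‖T 1‖ / c with hC
  have hC0 : 0 ≤ C := by positivity
  have hdom : T 1 ≤ (r / 2) • (1 : C(X, ℝ)) + C • T (T h) := by
    refine ContinuousMap.le_def.2 fun x => ?_
    have hTT := aux_app0 (hT _ (hT h hh0)) x
    simp only [ContinuousMap.add_apply, ContinuousMap.smul_apply, smul_eq_mul,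
      ContinuousMap.one_apply, mul_one, ContinuousMap.zero_apply] at *
    by_cases hx : r / 2 ≤ T 1 x
    · have h1 : T 1 x ≤ ‖T 1‖ := aux_norm (T 1) x
      have h2 := hcx x hx
      have h3 : C * c = ‖T 1‖ := by rw [hC]; field_simp
      nlinarith
    · nlinarith [mul_nonneg hC0 hTT]
  have hfn : f ≤ ‖f‖ • (1 : C(X, ℝ)) := by
    refine ContinuousMap.le_def.2 fun x => ?_
    simpa using aux_norm f x
  obtain ⟨x, hx⟩ : ∃ x, 0 < f x := by
    by_contra hcon
    push Not at hcon
    exact hf0 (ContinuousMap.ext fun x => le_antisymm (hcon x) (hf x))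
  -- pointwise estimate
  have hest : ∀ l, r < l →
      (l - r / 2 - C * l ^ 2 * (l - r) * ‖f‖) * resolvent T l 1 x ≤ 1 ∧
      f x ≤ (l - r) * ‖f‖ * resolvent T l 1 x := by
    intro l hl
    have hl0 : 0 < l := hr0.trans_lt hl
    have e1 := aux_app (hmono l hl _ _ hdom) x
    have e2 := congrArg (fun g : C(X, ℝ) => g x) (hRT l hl 1)
    have e3 := hRTT l hl h hh0 x
    have e4 := aux_app (hmono l hl _ _ hfn) x
    have e5 := congrArg (fun g : C(X, ℝ) => g x) (hRT l hl f)
    have e6 : resolvent T l h x = resolvent T l (T f) x - r * resolvent T l f x := by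
      rw [hh, map_sub, map_smul]; rfl
    have e7 := aux_app0 (hpos l hl h hh0) x
    rw [map_add, map_smul, map_smul] at e1
    rw [map_smul] at e4
    simp only [ContinuousMap.add_apply, ContinuousMap.sub_apply, ContinuousMap.smul_apply,
      smul_eq_mul, ContinuousMap.zero_apply, ContinuousMap.one_apply] at e1 e2 e3 e4 e5 e6 e7
    have e8 : resolvent T l h x + f x = (l - r) * resolvent T l f x := by
      rw [e6, e5]; ring
    have e9 : (l - r) * resolvent T l f x ≤ (l - r) * (‖f‖ * resolvent T l 1 x) :=
      mul_le_mul_of_nonneg_left e4 (by linarith)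
    constructor
    · have e10 : C * resolvent T l (T (T h)) x ≤
          C * (l ^ 2 * ((l - r) * (‖f‖ * resolvent T l 1 x))) := by
        apply mul_le_mul_of_nonneg_left _ hC0
        refine e3.trans (mul_le_mul_of_nonneg_left ?_ (by positivity))
        linarith
      nlinarith
    · nlinarith
  have hev1 : ∀ᶠ l in nhdsWithin r (Set.Ioi r),
      r / 4 < l - r / 2 - C * l ^ 2 * (l - r) * ‖f‖ := by
    apply Filter.Eventually.filter_mono nhdsWithin_le_nhds
    have : Continuous fun l : ℝ => l - r / 2 - C * l ^ 2 * (l - r) * ‖f‖ := by fun_prop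
    exact continuousAt_const.eventually_lt this.continuousAt (by simp; linarith)
  have hev2 : ∀ᶠ l in nhdsWithin r (Set.Ioi r), (l - r) * ‖f‖ * (4 / r) < f x := by
    apply Filter.Eventually.filter_mono nhdsWithin_le_nhds
    have : Continuous fun l : ℝ => (l - r) * ‖f‖ * (4 / r) := by fun_prop
    exact this.continuousAt.eventually_lt continuousAt_const (by simpa using hx)
  obtain ⟨l, ⟨hl1, hl2⟩, hl3⟩ := ((hev1.and hev2).and self_mem_nhdsWithin).exists
  have hlr : r < l := hl3
  obtain ⟨g1, g2⟩ := hest l hlr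
  have g3 : 0 ≤ resolvent T l 1 x := hpos l hlr 1 zero_le_one x
  have g4 : resolvent T l 1 x ≤ 4 / r := by
    rw [le_div_iff₀ hrpos]
    nlinarith
  have g5 : (l - r) * ‖f‖ * resolvent T l 1 x ≤ (l - r) * ‖f‖ * (4 / r) :=
    mul_le_mul_of_nonneg_left g4 (mul_nonneg (by linarith) (norm_nonneg _))
  linarith

end helpers

/-- If `f ≥ 0` is not identically zero and `T f ≥ r · f` pointwise, where `r` is the
spectral radius of `T`, then `T f = r · f`. -/
theorem stmt_7 {d : ℕ} (K : Set (EuclideanSpace ℝ (Fin d)))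
    [Nonempty ↥K] [CompactSpace ↥K]
    (hKint : (interior K).Nonempty) (hKreg : K = closure (interior K))
    (P : ↥K × ↥K → ℝ) (hPcont : Continuous P)
    (hPnonneg : ∀ x y : ↥K, 0 ≤ P (x, y))
    (hPpos : ∀ x y : ↥K, (x : EuclideanSpace ℝ (Fin d)) ∈ interior K →
      (y : EuclideanSpace ℝ (Fin d)) ∈ interior K → 0 < P (x, y))
    (hPsub : ∀ x : ↥K, ∫ y : ↥K, P (x, y) ∂(lebOn K) ≤ 1)
    (T : C(↥K, ℝ) →L[ℝ] C(↥K, ℝ))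
    (hT : ∀ (β : C(↥K, ℝ)) (x : ↥K), T β x = ∫ y : ↥K, β y * P (x, y) ∂(lebOn K))
    (f : C(↥K, ℝ)) (hf_nonneg : ∀ x : ↥K, 0 ≤ f x) (hf_ne : f ≠ 0)
    (hf_super : ∀ x : ↥K, (spectralRadius ℝ T).toReal * f x ≤ T f x) :
    T f = (spectralRadius ℝ T).toReal • f := by
  have hKc : IsCompact K := isCompact_iff_compactSpace.2 inferInstance
  have hKm : MeasurableSet K := hKc.measurableSet
  have hdense : ∀ U : Set ↥K, IsOpen U → U.Nonempty → ∃ y ∈ U, (y : EuclideanSpace ℝ (Fin d)) ∈ interior K := by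
    rintro U hU ⟨x, hx⟩
    obtain ⟨V, hV, rfl⟩ := isOpen_induced_iff.1 hU
    have hxc : (x : EuclideanSpace ℝ (Fin d)) ∈ closure (interior K) := hKreg ▸ x.2
    obtain ⟨y, hyV, hyK⟩ := mem_closure_iff.1 hxc V hV hx
    exact ⟨⟨y, interior_subset hyK⟩, hyV, hyK⟩
  have happ : ∀ s : Set ↥K, lebOn K s = volume (Subtype.val '' s) := fun s =>
    (MeasurableEmbedding.subtype_coe hKm).comap_apply _ s
  haveI : IsFiniteMeasure (lebOn K) := ⟨by
    rw [happ, Set.image_univ, Subtype.range_coe]; exact hKc.measure_lt_top⟩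
  haveI : (lebOn K).IsOpenPosMeasure := ⟨by
    intro U hU hne
    obtain ⟨y, hyU, hyK⟩ := hdense U hU hne
    obtain ⟨V, hV, rfl⟩ := isOpen_induced_iff.1 hU
    rw [happ, Subtype.image_preimage_coe]
    have h1 : 0 < volume (V ∩ interior K) :=
      (hV.inter isOpen_interior).measure_pos _ ⟨y, hyU, hyK⟩
    refine (h1.trans_le (measure_mono ?_)).ne'
    exact fun z hz => ⟨interior_subset hz.2, hz.1⟩⟩
  have hTpos : ∀ u : C(↥K, ℝ), 0 ≤ u → 0 ≤ T u := by
    intro u hu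
    refine ContinuousMap.le_def.2 fun x => ?_
    rw [hT]
    exact integral_nonneg fun y => mul_nonneg (hu y) (hPnonneg x y)
  have hstrict : ∀ u : C(↥K, ℝ), 0 ≤ u → ∀ x y, u y * P (x, y) ≠ 0 → 0 < T u x := by
    intro u hu x y hy
    rw [hT]
    have hc : Continuous fun y => u y * P (x, y) := by fun_prop
    exact hc.integral_pos_of_hasCompactSupport_nonneg_nonzero
      (HasCompactSupport.of_compactSpace _) (fun y => mul_nonneg (hu y) (hPnonneg x y)) hy
  have hTint : ∀ u : C(↥K, ℝ), 0 ≤ u → u ≠ 0 → ∀ x : ↥K,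
      (x : EuclideanSpace ℝ (Fin d)) ∈ interior K → 0 < T u x := by
    intro u hu hu0 x hx
    obtain ⟨z, hz⟩ : ∃ z, u z ≠ 0 := by
      by_contra hcon
      push Not at hcon
      exact hu0 (ContinuousMap.ext hcon)
    obtain ⟨y, hy, hyK⟩ := hdense {y | u y ≠ 0}
      (isOpen_ne_fun u.continuous continuous_const) ⟨z, hz⟩
    exact hstrict u hu x y (mul_ne_zero hy (hPpos x y hx hyK).ne')
  refine aux_main_s7 T hTpos _ ENNReal.toReal_nonneg ?_ ?_ ?_ f hf_nonneg hf_ne hf_super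
  · exact fun l hl => aux_spec T l hl
  · intro u hu hu0 x hx
    obtain ⟨z, hz⟩ : ∃ z, P (x, z) ≠ 0 := by
      by_contra hcon
      push Not at hcon
      rw [hT] at hx
      simp [hcon] at hx
    have hc : Continuous fun y => P (x, y) := by fun_prop
    obtain ⟨y, hy, hyK⟩ := hdense {y | P (x, y) ≠ 0}
      (isOpen_ne_fun hc continuous_const) ⟨z, hz⟩
    exact hstrict (T u) (hTpos u hu) x y (mul_ne_zero (hTint u hu hu0 y hyK).ne' hy)
  · obtain ⟨y, hy⟩ := hKint
    exact ⟨⟨y, interior_subset hy⟩, hTint 1 zero_le_one one_ne_zero _ hy⟩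
end

section
/- Let X be a complex Banach space, T, P : X → X continuous linear operators with P ∘ P = P, and let r be a real number with r > 0 such that T ∘ P = P ∘ T = r·P. Set N := T − r·P and assume P ∘ N = N ∘ P = 0 and that the spectral radius of N is strictly less than r. Then for every ψ₀ ∈ X with Pψ₀ ≠ 0, the normalized power-iteration sequence T^n ψ₀ / ‖T^n ψ₀‖ converges in norm, as n → ∞, to Pψ₀ / ‖Pψ₀‖ (in particular T^n ψ₀ ≠ 0 for all sufficiently large n). -/
open Filter Topology

/-- Convergence of the normalized power iteration: if `P` is a projection commuting with
`T` with `T∘P = P∘T = r·P`, `N := T − r·P` satisfies `P∘N = N∘P = 0` and has spectral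
radius strictly less than `r`, then for every `ψ₀` with `Pψ₀ ≠ 0` the normalized iterates
`T^n ψ₀ / ‖T^n ψ₀‖` converge to `Pψ₀ / ‖Pψ₀‖`
(in particular `T^n ψ₀ ≠ 0` for all sufficiently large `n`). -/
theorem stmt_12 {X : Type*} [NormedAddCommGroup X] [NormedSpace ℂ X] [CompleteSpace X]
    (T P : X →L[ℂ] X) (hP : P ∘L P = P)
    (r : ℝ) (hr : 0 < r)
    (hTP : T ∘L P = (r : ℂ) • P) (hPT : P ∘L T = (r : ℂ) • P)
    (N : X →L[ℂ] X) (hN : N = T - (r : ℂ) • P)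
    (hPN : P ∘L N = 0) (hNP : N ∘L P = 0)
    (hρ : spectralRadius ℂ N < ENNReal.ofReal r)
    (ψ₀ : X) (hψ₀ : P ψ₀ ≠ 0) :
    (∀ᶠ n : ℕ in atTop, (T ^ n) ψ₀ ≠ 0) ∧
    Tendsto (fun n : ℕ => ‖(T ^ n) ψ₀‖⁻¹ • (T ^ n) ψ₀) atTop
      (𝓝 (‖P ψ₀‖⁻¹ • P ψ₀)) := by
  have hTP' : ∀ x, T (P x) = (r : ℂ) • P x := fun x => by
    simpa using congrArg (fun f : X →L[ℂ] X => f x) hTP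
  have hPN' : ∀ x, P (N x) = 0 := fun x => by
    simpa using congrArg (fun f : X →L[ℂ] X => f x) hPN
  have hPP : ∀ x, P (P x) = P x := fun x => by
    simpa using congrArg (fun f : X →L[ℂ] X => f x) hP
  have h1 : ∀ n : ℕ, (T ^ n) (P ψ₀) = (r ^ n : ℝ) • P ψ₀ := by
    intro n
    induction n with
    | zero => simp
    | succ k ih =>
      rw [pow_succ, ContinuousLinearMap.mul_apply, hTP', map_smul, ih, pow_succ, mul_comm,
        mul_smul, Complex.coe_smul]
  have h2 : ∀ n : ℕ, ∀ φ, P φ = 0 → (T ^ n) φ = (N ^ n) φ := by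
    intro n
    induction n with
    | zero => simp
    | succ k ih =>
      intro φ hφ
      have hT : T φ = N φ := by simp [hN, hφ]
      rw [pow_succ, ContinuousLinearMap.mul_apply, hT, ih _ (hPN' φ), pow_succ,
        ContinuousLinearMap.mul_apply]
  obtain ⟨φ, hφ⟩ : ∃ φ, φ = ψ₀ - P ψ₀ := ⟨_, rfl⟩
  have hPφ : P φ = 0 := by rw [hφ, map_sub, hPP, sub_self]
  have h3 : ∀ n : ℕ, (r ^ n)⁻¹ • (T ^ n) ψ₀ = P ψ₀ + (r ^ n)⁻¹ • (N ^ n) φ := by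
    intro n
    have hψ : ψ₀ = P ψ₀ + φ := by rw [hφ]; abel
    have hrn : r ^ n ≠ 0 := (pow_pos hr n).ne'
    conv_lhs => rw [hψ]
    rw [map_add, h1, h2 n φ hPφ, smul_add, inv_smul_smul₀ hrn]
  obtain ⟨s, hs0, hs1, hs2⟩ := ENNReal.lt_iff_exists_real_btwn.1 hρ
  have hsr : s < r := by
    exact (ENNReal.ofReal_lt_ofReal_iff hr).1 hs2
  have hb : ∀ᶠ n : ℕ in atTop, ‖N ^ n‖ ≤ s ^ n := by
    have hg := spectrum.pow_norm_pow_one_div_tendsto_nhds_spectralRadius N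
    filter_upwards [hg.eventually_lt_const hs1, eventually_gt_atTop 0] with n hn hn0
    have h4 : ‖N ^ n‖ ^ (1 / n : ℝ) ≤ s := (ENNReal.ofReal_le_ofReal_iff hs0).1 hn.le
    have h5 := pow_le_pow_left₀ (Real.rpow_nonneg (norm_nonneg _) _) h4 n
    rwa [one_div, Real.rpow_inv_natCast_pow (norm_nonneg _) hn0.ne'] at h5
  have h6 : Tendsto (fun n : ℕ => (r ^ n)⁻¹ • (N ^ n) φ) atTop (𝓝 0) := by
    have h7 : Tendsto (fun n : ℕ => (s / r) ^ n * ‖φ‖) atTop (𝓝 0) := by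
      simpa using (tendsto_pow_atTop_nhds_zero_of_lt_one (div_nonneg hs0 hr.le)
        ((div_lt_one hr).2 hsr)).mul_const ‖φ‖
    refine squeeze_zero_norm' ?_ h7
    filter_upwards [hb] with n hn
    have hrn := pow_pos hr n
    rw [norm_smul, norm_inv, Real.norm_of_nonneg hrn.le, div_pow, div_eq_inv_mul, mul_assoc]
    gcongr
    exact (N ^ n).le_of_opNorm_le hn φ
  have h8 : Tendsto (fun n : ℕ => (r ^ n)⁻¹ • (T ^ n) ψ₀) atTop (𝓝 (P ψ₀)) := by
    simp only [h3]
    simpa using h6.const_add (P ψ₀)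
  constructor
  · filter_upwards [h8.eventually_ne hψ₀] with n hn h0
    exact hn (by rw [h0, smul_zero])
  · have h9 := (h8.norm.inv₀ (norm_ne_zero_iff.2 hψ₀)).smul h8
    refine h9.congr fun n => ?_
    have hrn := pow_pos hr n
    rw [norm_smul, norm_inv, Real.norm_of_nonneg hrn.le, mul_inv, inv_inv, smul_smul]
    congr 1
    field_simp
end

section
/- Let {T_t}_{t>0} be a family of continuous linear operators on C(K,ℝ) such that T_{t+s} = T_t ∘ T_s and ‖T_t β‖ ≤ ‖β‖ for all t, s > 0 and β ∈ C(K,ℝ), and suppose each T_t is positive. Fix s > 0, and suppose r_s > 0 and ψ ∈ C(K,ℝ) is nonnegative, not identically zero, satisfies T_s ψ = r_s·ψ, and the eigenspace {β ∈ C(K,ℝ) : T_s β = r_s·β} is one-dimensional. Then there exists a function c : (0,∞) → ℝ with c(s) = r_s, such that T_t ψ = c(t)·ψ for all t > 0, c(t+u) = c(t)·c(u) for all t, u > 0, and 0 < c(t) ≤ 1 for all t > 0; consequently there exists γ ≥ 0 with T_t ψ = exp(−γ·t)·ψ for all t > 0. -/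
theorem aux_additive (f : ℝ → ℝ) (h0 : ∀ t, 0 < t → 0 ≤ f t)
    (hadd : ∀ t u, 0 < t → 0 < u → f (t + u) = f t + f u) (t : ℝ) (ht : 0 < t) :
    f t = f 1 * t := by
  have hmono : ∀ a b, 0 < a → a ≤ b → f a ≤ f b := by
    intro a b ha hab
    rcases hab.eq_or_lt with rfl | h
    · exact le_rfl
    · have h1 := hadd a (b - a) ha (by linarith)
      have h2 := h0 (b - a) (by linarith)
      rw [add_sub_cancel] at h1
      linarith
  have hmul : ∀ (n : ℕ) (u : ℝ), 0 < u → f ((n + 1 : ℝ) * u) = (n + 1 : ℝ) * f u := by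
    intro n u hu
    induction n with
    | zero => simp
    | succ k ih =>
      have h1 := hadd ((k + 1 : ℝ) * u) u (by positivity) hu
      have h2 : ((k + 1 : ℕ) + 1 : ℝ) * u = (k + 1 : ℝ) * u + u := by push_cast; ring
      rw [h2, h1, ih]; push_cast; ring
  have hγ := h0 1 one_pos
  have key : ∀ n : ℕ, (n + 1 : ℝ) * |f t - f 1 * t| ≤ f 1 := by
    intro n
    have hnt : 0 < (n + 1 : ℝ) * t := by positivity
    have e := hmul n t ht
    have hk1 := Nat.floor_le hnt.le
    have hk2 := Nat.lt_floor_add_one ((n + 1 : ℝ) * t)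
    generalize ⌊(n + 1 : ℝ) * t⌋₊ = k at hk1 hk2
    have up : f ((n + 1 : ℝ) * t) ≤ (k + 1 : ℝ) * f 1 := by
      rw [← hmul k 1 one_pos]
      exact hmono _ _ hnt (by linarith)
    have lo : (k : ℝ) * f 1 ≤ f ((n + 1 : ℝ) * t) := by
      cases k with
      | zero => simpa using h0 _ hnt
      | succ j =>
        push_cast at hk1 ⊢
        rw [← hmul j 1 one_pos]
        exact hmono _ _ (by positivity) (by linarith)
    rw [← abs_of_pos (show (0 : ℝ) < n + 1 by positivity), ← abs_mul, abs_le]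
    constructor <;> nlinarith
  by_contra hne
  have hp : 0 < |f t - f 1 * t| := abs_pos.mpr (sub_ne_zero.mpr hne)
  obtain ⟨n, hn⟩ := exists_nat_gt (f 1 / |f t - f 1 * t|)
  rw [div_lt_iff₀ hp] at hn
  have := key n
  nlinarith

/-- For a non-expansive positive semigroup `{T_t}` on `C(K, ℝ)`, the dominant
eigenfunction `ψ` of `T_s` (with one-dimensional eigenspace) is a common eigenfunction of
all `T_t`, and the corresponding eigenvalues `c(t)` form a multiplicative family with
values in `(0, 1]`; consequently `T_t ψ = exp(−γ·t)·ψ` for some `γ ≥ 0`. -/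
theorem stmt_15 {d : ℕ} (K : Set (EuclideanSpace ℝ (Fin d)))
    [Nonempty ↥K] [CompactSpace ↥K]
    (T : ℝ → (C(↥K, ℝ) →L[ℝ] C(↥K, ℝ)))
    (hsemi : ∀ t s : ℝ, 0 < t → 0 < s → T (t + s) = (T t) ∘L (T s))
    (hcontr : ∀ t : ℝ, 0 < t → ∀ β : C(↥K, ℝ), ‖T t β‖ ≤ ‖β‖)
    (hpos : ∀ t : ℝ, 0 < t →
      ∀ β : C(↥K, ℝ), (∀ x : ↥K, 0 ≤ β x) → ∀ x : ↥K, 0 ≤ T t β x)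
    (s : ℝ) (hs : 0 < s) (rs : ℝ) (hrs : 0 < rs)
    (ψ : C(↥K, ℝ)) (hψ_nonneg : ∀ x : ↥K, 0 ≤ ψ x) (hψ_ne : ψ ≠ 0)
    (hTsψ : T s ψ = rs • ψ)
    (heig : Module.finrank ℝ
      ↥(Module.End.eigenspace (T s : C(↥K, ℝ) →ₗ[ℝ] C(↥K, ℝ)) rs) = 1) :
    ∃ c : ℝ → ℝ,
      c s = rs ∧
      (∀ t : ℝ, 0 < t → T t ψ = c t • ψ) ∧
      (∀ t u : ℝ, 0 < t → 0 < u → c (t + u) = c t * c u) ∧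
      (∀ t : ℝ, 0 < t → 0 < c t ∧ c t ≤ 1) ∧
      ∃ γ : ℝ, 0 ≤ γ ∧ ∀ t : ℝ, 0 < t → T t ψ = Real.exp (-γ * t) • ψ := by
  obtain ⟨x, hx⟩ : ∃ x, ψ x ≠ 0 := by
    by_contra! h
    exact hψ_ne (ContinuousMap.ext h)
  have hxp : 0 < ψ x := lt_of_le_of_ne (hψ_nonneg x) (Ne.symm hx)
  have hinj : ∀ a b : ℝ, a • ψ = b • ψ → a = b := fun a b h => smul_left_injective ℝ hψ_ne h
  have hex : ∀ t : ℝ, ∃ a : ℝ, 0 < t → T t ψ = a • ψ := by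
    intro t
    by_cases ht : 0 < t
    swap
    · exact ⟨0, fun h => absurd h ht⟩
    have hm : ψ ∈ Module.End.eigenspace (T s : C(↥K, ℝ) →ₗ[ℝ] C(↥K, ℝ)) rs :=
      Module.End.mem_eigenspace_iff.mpr hTsψ
    have hm2 : T t ψ ∈ Module.End.eigenspace (T s : C(↥K, ℝ) →ₗ[ℝ] C(↥K, ℝ)) rs := by
      refine Module.End.mem_eigenspace_iff.mpr ?_
      change T s (T t ψ) = rs • T t ψ
      have h1 : T s (T t ψ) = T (s + t) ψ := by rw [hsemi s t hs ht]; rfl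
      have h2 : T (t + s) ψ = T t (T s ψ) := by rw [hsemi t s ht hs]; rfl
      rw [h1, add_comm, h2, hTsψ, map_smul]
    have hne : (⟨ψ, hm⟩ : Module.End.eigenspace (T s : C(↥K, ℝ) →ₗ[ℝ] C(↥K, ℝ)) rs) ≠ 0 :=
      fun h => hψ_ne (congrArg Subtype.val h)
    obtain ⟨a, ha⟩ := (finrank_eq_one_iff_of_nonzero' _ hne).mp heig ⟨T t ψ, hm2⟩
    exact ⟨a, fun _ => (congrArg Subtype.val ha).symm⟩
  choose c hc using hex
  have hcs : c s = rs := hinj _ _ (by rw [← hc s hs, hTsψ])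
  have hcm : ∀ t u : ℝ, 0 < t → 0 < u → c (t + u) = c t * c u := by
    intro t u ht hu
    apply hinj
    rw [← hc (t + u) (by linarith), hsemi t u ht hu]
    change T t (T u ψ) = _
    rw [hc u hu, map_smul, hc t ht, smul_smul, mul_comm]
  have hc0 : ∀ t : ℝ, 0 < t → 0 ≤ c t := by
    intro t ht
    have h := hpos t ht ψ hψ_nonneg x
    rw [hc t ht] at h
    exact nonneg_of_mul_nonneg_left h hxp
  have hc1 : ∀ t : ℝ, 0 < t → c t ≤ 1 := by
    intro t ht
    have h := hcontr t ht ψ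
    rw [hc t ht, norm_smul, Real.norm_of_nonneg (hc0 t ht)] at h
    have hp : 0 < ‖ψ‖ := norm_pos_iff.mpr hψ_ne
    by_contra! h2
    nlinarith
  have hpw : ∀ n : ℕ, 0 < c ((n + 1 : ℝ) * s) := by
    intro n
    induction n with
    | zero => simpa [hcs] using hrs
    | succ k ih =>
      have h2 : ((k + 1 : ℕ) + 1 : ℝ) * s = (k + 1 : ℝ) * s + s := by push_cast; ring
      rw [h2, hcm _ _ (by positivity) hs, hcs]
      positivity
  have hcp : ∀ t : ℝ, 0 < t → 0 < c t := by
    intro t ht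
    refine lt_of_le_of_ne (hc0 t ht) fun h => ?_
    obtain ⟨n, hn⟩ := exists_nat_gt (t / s)
    rw [div_lt_iff₀ hs] at hn
    have h1 := hcm t ((n + 1 : ℝ) * s - t) ht (by linarith)
    rw [add_sub_cancel, ← h, zero_mul] at h1
    exact (hpw n).ne' h1
  refine ⟨c, hcs, hc, hcm, fun t ht => ⟨hcp t ht, hc1 t ht⟩, -Real.log (c 1), ?_, ?_⟩
  · have := Real.log_nonpos (hc0 1 one_pos) (hc1 1 one_pos)
    linarith
  · intro t ht
    have h := aux_additive (fun t => -Real.log (c t))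
      (fun t ht => by
        have := Real.log_nonpos (hc0 t ht) (hc1 t ht)
        linarith)
      (fun t u ht hu => by
        simp only [hcm t u ht hu, Real.log_mul (hcp t ht).ne' (hcp u hu).ne']
        ring) t ht
    rw [hc t ht, neg_mul, ← h, neg_neg, Real.exp_log (hcp t ht)]
end
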